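/- arXiv:1609.00089 — 2 statements merged into one kernel-verified Lean document; each statement's English description precedes it below -/
import Mathlib

section
/- Let G be a signed graph satisfying the odd cycle condition: for every pair of disjoint odd cycles C, C' lying in the same component, there exists a sign-alternating path in G from a vertex of C to a vertex of C'. Then the edge ring k[G] is a normal domain. -/
open Finset

/-- A signed graph: an undirected graph (possibly with loops) together with a
sign attached to each edge. -/
structure SignedGraph (V : Type) where
  edges : Finset (Sym2 V)
  sgn : Sym2 V → ℤ

namespace SignedGraph

variable {V : Type} [DecidableEq V]

/-- The sign function takes only the values `1` and `-1` on edges. -/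
def Proper (G : SignedGraph V) : Prop :=
  ∀ e ∈ G.edges, G.sgn e = 1 ∨ G.sgn e = -1

/-- `e_i + e_j` for the edge `ij` (a loop `ii` gives `2 e_i`). -/
def endSum : Sym2 V → (V → ℤ) :=
  Sym2.lift ⟨fun i j => Pi.single i 1 + Pi.single j 1, fun i j => add_comm _ _⟩

/-- `ρ(±ij) = sgn(ij)(e_i + e_j)`. -/
def rho (G : SignedGraph V) (e : Sym2 V) : V → ℤ := G.sgn e • endSum e

/-- A walk of length `len` in `G`, recorded by its vertex sequence. -/
structure Walk (G : SignedGraph V) (len : ℕ) where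
  vert : ℕ → V
  mem : ∀ i < len, s(vert i, vert (i + 1)) ∈ G.edges

namespace Walk

variable {G : SignedGraph V} {l l₁ l₂ : ℕ}

/-- The `i`-th edge of a walk. -/
def edge (W : G.Walk l) (i : ℕ) : Sym2 V := s(W.vert i, W.vert (i + 1))

def IsClosed (W : G.Walk l) : Prop := W.vert l = W.vert 0

/-- A cycle: a closed walk of positive length with pairwise distinct vertices
(length 2 is excluded since it would repeat an edge). -/
def IsCycle (W : G.Walk l) : Prop :=
  W.IsClosed ∧ 0 < l ∧ l ≠ 2 ∧ ∀ i < l, ∀ j < l, W.vert i = W.vert j → i = j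

/-- A path: a walk with pairwise distinct vertices. -/
def IsPath (W : G.Walk l) : Prop :=
  ∀ i ≤ l, ∀ j ≤ l, W.vert i = W.vert j → i = j

/-- The signs of consecutive edges alternate along the walk. -/
def Alternating (W : G.Walk l) : Prop :=
  ∀ i, i + 1 < l → G.sgn (W.edge (i + 1)) = -G.sgn (W.edge i)

/-- The signature of the vertex at position `i` of a cycle: the average of the
signs of the two incident edges of the cycle. -/
def sig (W : G.Walk l) (i : ℕ) : ℤ :=
  (G.sgn (W.edge ((i + l - 1) % l)) + G.sgn (W.edge (i % l))) / 2

/-- The exponent vector `∑_{v ∈ C} sig_C(v)·e_v` of the monomial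
`∏_{v ∈ C} x_v^{sig_C(v)}` attached to a cycle. -/
def cycVec (W : G.Walk l) : V → ℤ :=
  fun v => ∑ i ∈ Finset.range l, if W.vert i = v then W.sig i else 0

def edgeFinset (W : G.Walk l) : Finset (Sym2 V) := (Finset.range l).image W.edge

def edgeMS (W : G.Walk l) : Multiset (Sym2 V) := ((List.range l).map W.edge : Multiset (Sym2 V))

def HasVert (W : G.Walk l) (v : V) : Prop := ∃ i < l, W.vert i = v

/-- A reducing closed walk: a closed walk of even length such that whenever an
edge appears at two positions, the number of edges strictly between the two
occurrences is odd. -/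
def ReducingClosedWalk (W : G.Walk l) : Prop :=
  W.IsClosed ∧ Even l ∧
    ∀ i j, i < j → j < l → W.edge i = W.edge j → Odd (j - i - 1)

end Walk

/-- Two vertices lie in the same component iff some walk joins them. -/
def SameComponent (G : SignedGraph V) (u v : V) : Prop :=
  ∃ (n : ℕ) (W : G.Walk n), W.vert 0 = u ∧ W.vert n = v

/-- Two cycles are (vertex-)disjoint. -/
def DisjointCycles {G : SignedGraph V} {l₁ l₂ : ℕ} (C : G.Walk l₁) (C' : G.Walk l₂) : Prop :=
  ∀ i < l₁, ∀ j < l₂, C.vert i ≠ C'.vert j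

/-- There is a sign-alternating path from a vertex of `C` to a vertex of `C'`. -/
def AltPathBetween (G : SignedGraph V) {l₁ l₂ : ℕ} (C : G.Walk l₁) (C' : G.Walk l₂) : Prop :=
  ∃ (p : ℕ) (P : G.Walk p), P.IsPath ∧ P.Alternating ∧
    (∃ i < l₁, P.vert 0 = C.vert i) ∧ (∃ j < l₂, P.vert p = C'.vert j)

/-- The odd cycle condition for signed graphs. -/
def OddCycleCondition (G : SignedGraph V) : Prop :=
  ∀ (l₁ l₂ : ℕ) (C : G.Walk l₁) (C' : G.Walk l₂),
    C.IsCycle → C'.IsCycle → Odd l₁ → Odd l₂ → DisjointCycles C C' →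
    G.SameComponent (C.vert 0) (C'.vert 0) → AltPathBetween G C C'

end SignedGraph

/-- The monomial `x^z` in the Laurent polynomial ring
`k[x_v^{±1} : v ∈ V] = k[(V → ℤ)]`. -/
noncomputable def mono (k : Type) [Field k] {V : Type} (z : V → ℤ) :
    AddMonoidAlgebra k (V → ℤ) :=
  AddMonoidAlgebra.single z 1

/-- The edge ring `k[G]` of a signed graph, generated by the monomials
`(x_i x_j)^{sgn(ij)}` over the edges of `G`. -/
noncomputable def edgeRing (k : Type) [Field k] {V : Type} [DecidableEq V] (G : SignedGraph V) :
    Subalgebra k (AddMonoidAlgebra k (V → ℤ)) :=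
  Algebra.adjoin k ((fun e => mono k (G.rho e)) '' ↑G.edges)

namespace AddMonoidAlgebra

variable {k L : Type} [Field k]

theorem eq_of_coeff_single_ne_zero {m x : L} {r : k} (h : (single m r).coeff x ≠ 0) : x = m := by
  by_contra hx
  exact h (by rw [coeff_single, Finsupp.single_eq_of_ne hx])

variable [AddCommGroup L]

theorem coeff_mul_mem {T₁ T₂ T₃ : Set L} (hT : ∀ a ∈ T₁, ∀ b ∈ T₂, a + b ∈ T₃)
    {f g : AddMonoidAlgebra k L} (hf : ∀ m, f.coeff m ≠ 0 → m ∈ T₁)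
    (hg : ∀ m, g.coeff m ≠ 0 → m ∈ T₂) (m : L) (hm : (f * g).coeff m ≠ 0) : m ∈ T₃ := by
  classical
  have := support_coeff_mul_subset f g (Finsupp.mem_support_iff.2 hm)
  obtain ⟨a, ha, b, hb, rfl⟩ := Finset.mem_add.1 this
  exact hT a (hf a (Finsupp.mem_support_iff.1 ha)) b (hg b (Finsupp.mem_support_iff.1 hb))

/-- The elements of `k[L]` whose exponents lie in the submonoid `P`. -/
noncomputable def supportedSubalgebra (k : Type) [Field k] (P : AddSubmonoid L) :
    Subalgebra k (AddMonoidAlgebra k L) where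
  carrier := {f | ∀ m, f.coeff m ≠ 0 → m ∈ P}
  mul_mem' := coeff_mul_mem fun _ ha _ hb => P.add_mem ha hb
  add_mem' := by
    intro f g hf hg m hm
    by_contra h
    have h1 : f.coeff m = 0 := by by_contra h'; exact h (hf m h')
    have h2 : g.coeff m = 0 := by by_contra h'; exact h (hg m h')
    exact hm (by simp [h1, h2])
  algebraMap_mem' := by
    intro r m hm
    have : m = 0 := eq_of_coeff_single_ne_zero hm
    exact this ▸ P.zero_mem

theorem single_mem_supportedSubalgebra {P : AddSubmonoid L} {m : L} (hm : m ∈ P) (r : k) :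
    single m r ∈ supportedSubalgebra k P := by
  intro x hx
  rwa [eq_of_coeff_single_ne_zero hx]

theorem adjoin_single_eq_supportedSubalgebra (A : Set L) :
    Algebra.adjoin k ((fun m => single m (1 : k)) '' A) =
      supportedSubalgebra k (AddSubmonoid.closure A) := by
  apply le_antisymm
  · rw [Algebra.adjoin_le_iff]
    rintro _ ⟨m, hm, rfl⟩
    exact single_mem_supportedSubalgebra (AddSubmonoid.subset_closure hm) 1
  · intro f hf
    have key : ∀ m ∈ AddSubmonoid.closure A,
        single m (1 : k) ∈ Algebra.adjoin k ((fun m => single m (1 : k)) '' A) := by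
      intro m hm
      induction hm using AddSubmonoid.closure_induction with
      | mem x hx => exact Algebra.subset_adjoin ⟨x, hx, rfl⟩
      | zero => exact one_mem _
      | add x y _ _ hx hy => simpa [single_mul_single] using mul_mem hx hy
    have hs : f = ∑ m ∈ f.coeff.support, f.coeff m • single m (1 : k) := by
      apply coeff_injective
      simp only [coeff_sum, coeff_smul, coeff_single, Finsupp.smul_single, smul_eq_mul, mul_one]
      exact (Finsupp.sum_single f.coeff).symm
    rw [hs]
    refine sum_mem fun m hm => Subalgebra.smul_mem _ (key m ?_) _
    exact hf m (Finsupp.mem_support_iff.1 hm)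

/-- The monomials with exponents in a submonoid `P` satisfying `P ∪ -P = L` behave like a
valuation ring of `k[L]`. -/
theorem mem_supportedSubalgebra_of_isIntegral_of_total [NoZeroDivisors (AddMonoidAlgebra k L)]
    {P : AddSubmonoid L} (hP : ∀ x, x ∈ P ∨ -x ∈ P) {f : AddMonoidAlgebra k L}
    (hf : IsIntegral (supportedSubalgebra k P) f) : f ∈ supportedSubalgebra k P := by
  classical
  by_contra hfP
  have hmin : ∀ s : Finset L, s.Nonempty → ∃ m₀ ∈ s, ∀ m ∈ s, m - m₀ ∈ P := by
    intro s hs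
    induction hs using Finset.Nonempty.cons_induction with
    | singleton a => exact ⟨a, by simp, by simp [P.zero_mem]⟩
    | cons a s ha hs ih =>
      obtain ⟨m₀, hm₀, h⟩ := ih
      rcases hP (a - m₀) with h1 | h1
      · refine ⟨m₀, by simp [hm₀], ?_⟩
        intro m hm
        rcases Finset.mem_cons.1 hm with rfl | hm
        exacts [h1, h m hm]
      · refine ⟨a, by simp, ?_⟩
        intro m hm
        rcases Finset.mem_cons.1 hm with rfl | hm
        · simp [P.zero_mem]
        · have := P.add_mem (h m hm) h1
          simpa using this
  have hne : f.coeff.support.Nonempty := by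
    by_contra h
    apply hfP
    rw [Finset.not_nonempty_iff_eq_empty, Finsupp.support_eq_empty, coeff_eq_zero] at h
    rw [h]; exact zero_mem _
  obtain ⟨m₀, hm₀, hm⟩ := hmin _ hne
  have hm₀P : m₀ ∉ P := by
    intro h
    apply hfP
    intro m hm'
    have := P.add_mem (hm m (Finsupp.mem_support_iff.2 hm')) h
    simpa using this
  have hnm₀ : -m₀ ∈ P := (hP m₀).resolve_left hm₀P
  let I : Set L := {x | x ∈ P ∧ -x ∉ P}
  let U : Set L := {x | x ∈ P ∧ -x ∈ P}
  have hIP : ∀ a ∈ I, ∀ b ∈ (P : Set L), a + b ∈ I := by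
    rintro a ⟨ha, ha'⟩ b hb
    refine ⟨P.add_mem ha hb, fun h => ha' ?_⟩
    have := P.add_mem h hb
    simpa using this
  have hUU : ∀ a ∈ U, ∀ b ∈ U, a + b ∈ U := by
    rintro a ⟨ha, ha'⟩ b ⟨hb, hb'⟩
    refine ⟨P.add_mem ha hb, ?_⟩
    rw [neg_add]
    exact P.add_mem ha' hb'
  have hIadd : ∀ x y : AddMonoidAlgebra k L, (∀ m, x.coeff m ≠ 0 → m ∈ I) →
      (∀ m, y.coeff m ≠ 0 → m ∈ I) → (∀ m, (x + y).coeff m ≠ 0 → m ∈ I) := by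
    intro x y hx hy m hm
    by_contra h
    have h1 : x.coeff m = 0 := by by_contra h'; exact h (hx m h')
    have h2 : y.coeff m = 0 := by by_contra h'; exact h (hy m h')
    exact hm (by simp [h1, h2])
  set u : AddMonoidAlgebra k L := single (-m₀) 1 with hu
  set g := u * f with hg
  have hgcoeff : ∀ m, g.coeff m = f.coeff (m + m₀) := by
    intro m
    rw [hg, hu]
    have := coeff_single_mul_apply f (1 : k) (-m₀) m
    rw [this]; simp [add_comm]
  have hgP : ∀ m, g.coeff m ≠ 0 → m ∈ (P : Set L) := by
    intro m h
    rw [hgcoeff] at h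
    simpa using hm _ (Finsupp.mem_support_iff.2 h)
  -- splitting `g` into its leading part and the rest
  let g₀ : AddMonoidAlgebra k L := ofCoeff (g.coeff.filter (· ∈ U))
  let g₁ : AddMonoidAlgebra k L := ofCoeff (g.coeff.filter (fun m => ¬ m ∈ U))
  have hgg : g = g₀ + g₁ := by
    apply coeff_injective
    exact (Finsupp.filter_add_filter_not g.coeff (· ∈ U)).symm
  have hg₀U : ∀ m, g₀.coeff m ≠ 0 → m ∈ U := by
    intro m h
    by_contra h'
    exact h (Finsupp.filter_apply_neg (· ∈ U) _ h')
  have hg₁I : ∀ m, g₁.coeff m ≠ 0 → m ∈ I := by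
    intro m h
    have h1 : m ∉ U := by
      intro h'
      exact h (Finsupp.filter_apply_neg (fun m => ¬ m ∈ U) _ (not_not.2 h'))
    have h2 : m ∈ P := by
      apply hgP
      intro h3
      exact h (by rw [show g₁.coeff m = g.coeff m from Finsupp.filter_apply_pos _ _ h1, h3])
    exact ⟨h2, fun h3 => h1 ⟨h2, h3⟩⟩
  have hg₀ne : g₀ ≠ 0 := by
    intro h
    have h0 : g₀.coeff 0 = g.coeff 0 :=
      Finsupp.filter_apply_pos (· ∈ U) _ ⟨P.zero_mem, by simp [P.zero_mem]⟩
    rw [h, hgcoeff, zero_add] at h0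
    exact (Finsupp.mem_support_iff.1 hm₀) h0.symm
  have hgpow : ∀ n (m : L), (g ^ n).coeff m ≠ 0 → m ∈ (P : Set L) := fun n =>
    pow_mem (S := supportedSubalgebra k P) (x := g) hgP n
  have hg₀pow : ∀ n (m : L), (g₀ ^ n).coeff m ≠ 0 → m ∈ U := by
    intro n
    induction n with
    | zero =>
      intro m h
      have : m = 0 := eq_of_coeff_single_ne_zero h
      rw [this]; exact ⟨P.zero_mem, by simp [P.zero_mem]⟩
    | succ n ih => rw [pow_succ]; exact coeff_mul_mem hUU ih hg₀U
  have hdiff : ∀ n (m : L), (g ^ n - g₀ ^ n).coeff m ≠ 0 → m ∈ I := by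
    intro n
    induction n with
    | zero => simp
    | succ n ih =>
      have : g ^ (n + 1) - g₀ ^ (n + 1) = (g ^ n - g₀ ^ n) * g + g₁ * g₀ ^ n := by
        rw [pow_succ, pow_succ, hgg]; ring
      rw [this]
      exact hIadd _ _ (coeff_mul_mem hIP ih hgP)
        (coeff_mul_mem hIP hg₁I fun m h => (hg₀pow n m h).1)
  have hupow : ∀ n (m : L), 0 < n → (u ^ n).coeff m ≠ 0 → m ∈ I := by
    intro n m hn h
    rw [hu, single_pow] at h
    have : m = n • (-m₀) := eq_of_coeff_single_ne_zero h
    obtain ⟨n, rfl⟩ := Nat.exists_eq_succ_of_ne_zero hn.ne'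
    rw [this, succ_nsmul']
    exact hIP _ ⟨hnm₀, by simpa using hm₀P⟩ _ (P.nsmul_mem hnm₀ n)
  obtain ⟨p, hp, hpf⟩ := hf
  set n := p.natDegree with hn
  have hgI : ∀ m, (g ^ n).coeff m ≠ 0 → m ∈ I := by
    have h1 : g ^ n = ∑ i ∈ range n,
        u ^ (n - i) * (-(p.coeff i : AddMonoidAlgebra k L) * g ^ i) := by
      rw [Polynomial.eval₂_eq_sum_range, Finset.sum_range_succ, ← hn] at hpf
      have h2 : p.coeff n = 1 := hp
      rw [h2, map_one, one_mul] at hpf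
      have h3 : f ^ n = ∑ i ∈ range n, -(p.coeff i : AddMonoidAlgebra k L) * f ^ i := by
        rw [← sub_eq_zero, ← hpf]
        simp only [neg_mul, Finset.sum_neg_distrib, sub_neg_eq_add]
        rw [add_comm]; rfl
      rw [hg, mul_pow, h3, Finset.mul_sum]
      refine Finset.sum_congr rfl fun i hi => ?_
      have : n = (n - i) + i := by have := Finset.mem_range.1 hi; omega
      rw [mul_pow]
      conv_lhs => rw [this, pow_add]
      ring
    rw [h1]
    have : ∀ s ⊆ range n, ∀ m, (∑ i ∈ s,
        u ^ (n - i) * (-(p.coeff i : AddMonoidAlgebra k L) * g ^ i)).coeff m ≠ 0 → m ∈ I := by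
      intro s hs
      induction s using Finset.induction_on with
      | empty => simp
      | insert i s hi ih =>
        rw [Finset.sum_insert hi]
        refine hIadd _ _ ?_ (ih fun x hx => hs (Finset.mem_insert_of_mem hx))
        refine coeff_mul_mem hIP (fun m h => hupow _ m ?_ h)
          (Subalgebra.mul_mem (supportedSubalgebra k P) (neg_mem (p.coeff i).2) (hgpow i))
        have := Finset.mem_range.1 (hs (Finset.mem_insert_self i s))
        omega
    exact this _ subset_rfl
  apply pow_ne_zero n hg₀ne
  apply coeff_injective
  ext m
  by_contra h
  have hU := hg₀pow n m h
  have hI : m ∈ I := by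
    by_contra h'
    have h1 : (g ^ n).coeff m = 0 := by by_contra h2; exact h' (hgI m h2)
    have h2 : (g ^ n - g₀ ^ n).coeff m = 0 := by by_contra h2; exact h' (hdiff n m h2)
    rw [coeff_sub, Finsupp.sub_apply, h1, zero_sub, neg_eq_zero] at h2
    exact h h2
  exact hI.2 hU.2

end AddMonoidAlgebra

/-- A saturated submonoid is an intersection of submonoids `P` with `P ∪ -P = L`. -/
theorem AddSubmonoid.exists_le_total_of_saturated {L : Type} [AddCommGroup L] {S : AddSubmonoid L}
    (hS : ∀ (n : ℕ) (x : L), 0 < n → n • x ∈ S → x ∈ S) {m : L} (hm : m ∉ S) :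
    ∃ P : AddSubmonoid L, S ≤ P ∧ (∀ x, x ∈ P ∨ -x ∈ P) ∧ m ∉ P := by
  let Q : Set (AddSubmonoid L) :=
    {P | (∀ (n : ℕ) (x : L), 0 < n → n • x ∈ P → x ∈ P) ∧ m ∉ P}
  obtain ⟨P, hSP, hPmax⟩ := zorn_le_nonempty₀ Q (by
    intro c hcQ hc y hy
    refine ⟨sSup c, ⟨?_, ?_⟩, fun z hz => le_sSup hz⟩
    · intro n x hn hx
      rw [AddSubmonoid.mem_sSup_of_directedOn ⟨y, hy⟩ hc.directedOn] at hx ⊢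
      obtain ⟨s, hs, hx⟩ := hx
      exact ⟨s, hs, (hcQ hs).1 n x hn hx⟩
    · rw [AddSubmonoid.mem_sSup_of_directedOn ⟨y, hy⟩ hc.directedOn]
      rintro ⟨s, hs, hx⟩
      exact (hcQ hs).2 hx) S ⟨hS, hm⟩
  obtain ⟨hPsat, hmP⟩ := hPmax.prop
  refine ⟨P, hSP, ?_, hmP⟩
  -- a maximal element cannot be enlarged by `x`
  have key : ∀ x, x ∉ P → ∃ (n a : ℕ) (p : L), 0 < n ∧ p ∈ P ∧ n • m = p + a • x := by
    intro x hx
    let R : AddSubmonoid L :=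
      { carrier := {y | ∃ (n a : ℕ) (p : L), 0 < n ∧ p ∈ P ∧ n • y = p + a • x}
        zero_mem' := ⟨1, 0, 0, one_pos, P.zero_mem, by simp⟩
        add_mem' := by
          rintro y z ⟨n, a, p, hn, hp, h⟩ ⟨n', a', p', hn', hp', h'⟩
          refine ⟨n * n', n' * a + n * a', n' • p + n • p', Nat.mul_pos hn hn',
            P.add_mem (P.nsmul_mem hp _) (P.nsmul_mem hp' _), ?_⟩
          have e1 : (n * n') • y = n' • (p + a • x) := by rw [← h, ← mul_nsmul]
          have e2 : (n * n') • z = n • (p' + a' • x) := by rw [← h', mul_comm, ← mul_nsmul]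
          rw [nsmul_add, e1, e2, nsmul_add, nsmul_add, add_nsmul, ← mul_nsmul', ← mul_nsmul']
          abel }
    by_contra hcon
    have hRQ : R ∈ Q := by
      refine ⟨?_, hcon⟩
      rintro n y hn ⟨n', a, p, hn', hp, h⟩
      exact ⟨n' * n, a, p, Nat.mul_pos hn' hn, hp, by rw [← h, mul_nsmul']⟩
    have hPR : P ≤ R := fun y hy => ⟨1, 0, y, one_pos, hy, by simp⟩
    exact hx (hPmax.le_of_ge hRQ hPR ⟨1, 1, 0, one_pos, P.zero_mem, by simp⟩)
  intro x
  by_contra! hx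
  obtain ⟨n, a, p, hn, hp, h⟩ := key x hx.1
  obtain ⟨n', a', p', hn', hp', h'⟩ := key (-x) hx.2
  rcases Nat.eq_zero_or_pos a with rfl | ha
  · exact hmP (hPsat n m hn (by rw [h]; simpa using hp))
  refine hmP (hPsat (a' * n + a * n') m (by positivity) ?_)
  have : (a' * n + a * n') • m = a' • p + a • p' := by
    rw [add_nsmul, mul_nsmul', mul_nsmul', h, h', nsmul_add, nsmul_add, ← mul_nsmul',
      ← mul_nsmul', mul_comm a' a, smul_neg]
    abel
  rw [this]
  exact P.add_mem (P.nsmul_mem hp _) (P.nsmul_mem hp' _)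

namespace AddMonoidAlgebra

/-- Laurent polynomials are a localization of polynomials. -/
theorem isIntegrallyClosed_finsupp_int (k σ : Type) [Field k] [Finite σ] :
    IsIntegrallyClosed (AddMonoidAlgebra k (σ →₀ ℤ)) := by
  classical
  have := Fintype.ofFinite σ
  let c : (σ →₀ ℕ) →+ (σ →₀ ℤ) := Finsupp.mapRange.addMonoidHom (Nat.castAddMonoidHom ℤ)
  have hc : Function.Injective c := Finsupp.mapRange_injective _ rfl Nat.cast_injective
  let φ : AddMonoidAlgebra k (σ →₀ ℕ) →+* AddMonoidAlgebra k (σ →₀ ℤ) := mapDomainRingHom k c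
  have hφ : Function.Injective φ := mapDomain_injective hc
  have hφs : ∀ m (r : k), φ (single m r) = single (c m) r := fun m r => mapDomain_single
  let M : Submonoid (AddMonoidAlgebra k (σ →₀ ℕ)) :=
    { carrier := Set.range fun m => single m (1 : k)
      one_mem' := ⟨0, rfl⟩
      mul_mem' := by
        rintro _ _ ⟨a, rfl⟩ ⟨b, rfl⟩
        exact ⟨a + b, by simp [single_mul_single]⟩ }
  let : Algebra (AddMonoidAlgebra k (σ →₀ ℕ)) (AddMonoidAlgebra k (σ →₀ ℤ)) := φ.toAlgebra
  have hden : ∀ f : AddMonoidAlgebra k (σ →₀ ℤ), ∃ (m : σ →₀ ℕ) (g : AddMonoidAlgebra k (σ →₀ ℕ)),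
      f * single (c m) 1 = φ g := by
    intro f
    let m : σ →₀ ℕ := ∑ a ∈ f.coeff.support, a.mapRange Int.natAbs rfl
    refine ⟨m, ?_⟩
    have : ∀ a ∈ f.coeff.support, ∃ b, c b = a + c m := by
      intro a ha
      refine ⟨(a + c m).mapRange Int.toNat rfl, ?_⟩
      ext i
      have h1 : (c m) i = (m i : ℤ) := rfl
      have h2 : (a i).natAbs ≤ m i := by
        rw [show m i = ∑ a ∈ f.coeff.support, (a.mapRange Int.natAbs rfl) i from
          Finsupp.finsetSum_apply _ _ _]
        exact Finset.single_le_sum (f := fun a : σ →₀ ℤ => (a.mapRange Int.natAbs rfl) i)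
          (fun _ _ => Nat.zero_le _) ha
      have h3 : 0 ≤ a i + m i := by omega
      change (((a + c m) i).toNat : ℤ) = (a + c m) i
      rw [Finsupp.add_apply, h1, Int.toNat_of_nonneg h3]
    choose! b hb using this
    refine ⟨∑ a ∈ f.coeff.support, single (b a) (f.coeff a), ?_⟩
    have hs : f = ∑ m ∈ f.coeff.support, single m (f.coeff m) := by
      apply coeff_injective
      rw [coeff_sum]
      exact (Finsupp.sum_single f.coeff).symm
    conv_lhs => rw [hs]
    rw [Finset.sum_mul, map_sum φ]
    refine Finset.sum_congr rfl fun a ha => ?_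
    rw [hφs, hb a ha, single_mul_single, mul_one]
  have hloc : IsLocalization M (AddMonoidAlgebra k (σ →₀ ℤ)) := by
    refine ⟨?_, ?_, ?_⟩
    · rintro ⟨_, m, rfl⟩
      change IsUnit (φ (single m 1))
      rw [hφs]
      refine IsUnit.of_mul_eq_one (single (-c m) 1) ?_
      simp [single_mul_single, one_def]
    · intro f
      obtain ⟨m, g, h⟩ := hden f
      refine ⟨(g, ⟨single m 1, m, rfl⟩), ?_⟩
      change f * φ (single m 1) = φ g
      rw [hφs, h]
    · intro x y h
      exact ⟨1, by rw [hφ h]⟩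
  have : IsIntegrallyClosed (AddMonoidAlgebra k (σ →₀ ℕ)) :=
    inferInstanceAs (IsIntegrallyClosed (MvPolynomial σ k))
  have : IsDomain (AddMonoidAlgebra k (σ →₀ ℕ)) := inferInstanceAs (IsDomain (MvPolynomial σ k))
  refine isIntegrallyClosed_of_isLocalization _ M ?_
  rintro _ ⟨m, rfl⟩
  rw [mem_nonZeroDivisors_iff_ne_zero]
  intro h
  simpa using (congrArg (fun x => x.coeff m) h)

theorem isIntegrallyClosed_of_free (k L : Type) [Field k] [AddCommGroup L] [Module.Free ℤ L]
    [Module.Finite ℤ L] : IsIntegrallyClosed (AddMonoidAlgebra k L) := by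
  have := isIntegrallyClosed_finsupp_int k (Module.Free.ChooseBasisIndex ℤ L)
  exact IsIntegrallyClosed.of_equiv
    (domCongr k k (Module.Free.chooseBasis ℤ L).repr.symm.toAddEquiv).toRingEquiv

/-- The semigroup ring of a saturated submonoid of a lattice is normal. -/
theorem isIntegrallyClosed_supportedSubalgebra (k : Type) {L : Type} [Field k] [AddCommGroup L]
    [Module.Free ℤ L] [Module.Finite ℤ L] [IsDomain (AddMonoidAlgebra k L)] {S : AddSubmonoid L}
    (hS : ∀ (n : ℕ) (x : L), 0 < n → n • x ∈ S → x ∈ S) :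
    IsIntegrallyClosed (supportedSubalgebra k S) := by
  have hL := isIntegrallyClosed_of_free k L
  let R := supportedSubalgebra k S
  let B := AddMonoidAlgebra k L
  let K := FractionRing R
  let F := FractionRing B
  have hinj : Function.Injective (algebraMap R B) := Subtype.val_injective
  have hinjF : Function.Injective (algebraMap B F) := IsFractionRing.injective B F
  have hRF : Function.Injective ((algebraMap B F).comp (algebraMap R B)) := hinjF.comp hinj
  let ψ : K →+* F := IsFractionRing.lift hRF
  have hψ : ∀ r : R, ψ (algebraMap R K r) = algebraMap B F r :=
    fun r => IsFractionRing.lift_algebraMap hRF r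
  refine (isIntegrallyClosed_iff K).2 fun {x} hx => ?_
  obtain ⟨p, hp, hpx⟩ := hx
  have hpF : Polynomial.eval₂ ((algebraMap B F).comp (algebraMap R B)) (ψ x) p = 0 := by
    have h := congrArg ψ hpx
    rw [map_zero, Polynomial.hom_eval₂] at h
    rw [← h]
    congr 1
    ext r
    exact (hψ r).symm
  have hB : IsIntegral B (ψ x) := by
    refine ⟨p.map (algebraMap R B), hp.map _, ?_⟩
    rw [Polynomial.eval₂_map]; exact hpF
  obtain ⟨f, hf⟩ := IsIntegrallyClosed.algebraMap_eq_of_integral hB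
  have hfp : Polynomial.eval₂ (algebraMap R B) f p = 0 := by
    apply hinjF
    rw [Polynomial.hom_eval₂, hf, hpF, map_zero]
  have hfS : f ∈ R := by
    intro m hm
    by_contra hmS
    obtain ⟨P, hSP, hP, hmP⟩ := AddSubmonoid.exists_le_total_of_saturated hS hmS
    have hle : R ≤ supportedSubalgebra k P := fun g hg m hm => hSP (hg m hm)
    have : IsIntegral (supportedSubalgebra k P) f := by
      refine ⟨p.map (Subalgebra.inclusion hle).toRingHom, hp.map _, ?_⟩
      rw [Polynomial.eval₂_map]
      exact hfp
    exact hmP (mem_supportedSubalgebra_of_isIntegral_of_total hP this m hm)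
  refine ⟨⟨f, hfS⟩, ψ.injective ?_⟩
  rw [hψ, ← hf]

/-- The algebra generated by finitely many monomials is normal when the exponents generate a
saturated submonoid of their lattice. -/
theorem isIntegrallyClosed_adjoin_single (k : Type) {M : Type} [Field k] [AddCommGroup M]
    [IsDomain (AddMonoidAlgebra k M)] [Module.IsTorsionFree ℤ M] {A : Set M} (hA : A.Finite)
    (h : ∀ (n : ℕ), ∀ x ∈ AddSubgroup.closure A, 0 < n → n • x ∈ AddSubmonoid.closure A →
      x ∈ AddSubmonoid.closure A) :
    IsIntegrallyClosed (Algebra.adjoin k ((fun m => single m (1 : k)) '' A)) := by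
  let L := Submodule.span ℤ A
  let ι : L →+ M := L.subtype.toAddMonoidHom
  have hι : Function.Injective ι := Subtype.val_injective
  let A' : Set L := ι ⁻¹' A
  have hA' : ι '' A' = A := by
    rw [Set.image_preimage_eq_iff]
    intro a ha
    exact ⟨⟨a, Submodule.subset_span ha⟩, rfl⟩
  have hcl : ∀ x : L, x ∈ AddSubmonoid.closure A' ↔ (x : M) ∈ AddSubmonoid.closure A := by
    intro x
    rw [← hA', ← AddMonoidHom.map_mclosure]
    exact (AddSubmonoid.mem_map_iff_mem hι).symm
  have : Module.Finite ℤ L := Module.Finite.span_of_finite ℤ hA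
  let φ : AddMonoidAlgebra k L →ₐ[k] AddMonoidAlgebra k M := mapDomainAlgHom k k ι
  have hφ : Function.Injective φ := mapDomain_injective hι
  have : IsDomain (AddMonoidAlgebra k L) := hφ.isDomain φ.toRingHom
  have hS := isIntegrallyClosed_supportedSubalgebra k (S := AddSubmonoid.closure A') (by
    intro n x hn hx
    rw [hcl] at hx ⊢
    refine h n x ?_ hn (by simpa using hx)
    have := x.2
    rwa [← Submodule.mem_toAddSubgroup, Submodule.span_int_eq_addSubgroupClosure] at this)
  rw [← adjoin_single_eq_supportedSubalgebra] at hS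
  have hmap : Algebra.adjoin k ((fun m => single m (1 : k)) '' A) =
      (Algebra.adjoin k ((fun m => single m (1 : k)) '' A')).map φ := by
    rw [AlgHom.map_adjoin]
    congr 1
    conv_lhs => rw [← hA']
    rw [Set.image_image, Set.image_image]
    refine Set.image_congr fun a _ => ?_
    exact mapDomain_single.symm
  rw [hmap]
  exact IsIntegrallyClosed.of_equiv (Subalgebra.equivMapOfInjective _ φ hφ).toRingEquiv

end AddMonoidAlgebra

namespace SignedGraph

variable {V : Type} [DecidableEq V] {G : SignedGraph V}

theorem endSum_mk (a b v : V) :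
    endSum s(a, b) v = (if a = v then 1 else 0) + (if b = v then 1 else 0) := by
  simp [endSum, Pi.single_apply, eq_comm]

theorem endSum_nonneg (e : Sym2 V) (v : V) : 0 ≤ endSum e v := by
  induction e with
  | _ a b => rw [endSum_mk]; positivity

theorem endSum_eq_zero {e : Sym2 V} {v : V} (h : v ∉ e) : endSum e v = 0 := by
  induction e with
  | _ a b =>
    rw [Sym2.mem_iff, not_or] at h
    rw [endSum_mk, if_neg (Ne.symm h.1), if_neg (Ne.symm h.2), add_zero]

theorem one_le_endSum {e : Sym2 V} {v : V} (h : v ∈ e) : 1 ≤ endSum e v := by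
  induction e with
  | _ a b =>
    rw [endSum_mk]
    rcases Sym2.mem_iff.1 h with rfl | rfl
    · rw [if_pos rfl]; split_ifs <;> norm_num
    · rw [if_pos rfl]; split_ifs <;> norm_num

theorem endSum_of_isDiag {e : Sym2 V} {v : V} (h : v ∈ e) (hd : e.IsDiag) : endSum e v = 2 := by
  induction e with
  | _ a b =>
    obtain rfl : a = b := hd
    obtain rfl : v = a := by simpa using h
    rw [endSum_mk, if_pos rfl]; rfl

theorem endSum_of_not_isDiag {e : Sym2 V} {v : V} (h : v ∈ e) (hd : ¬ e.IsDiag) :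
    endSum e v = 1 := by
  induction e with
  | _ a b =>
    have hab : a ≠ b := hd
    rw [endSum_mk]
    rcases Sym2.mem_iff.1 h with rfl | rfl
    · rw [if_pos rfl, if_neg hab.symm, add_zero]
    · rw [if_pos rfl, if_neg hab, zero_add]

theorem sum_endSum {T : Finset V} {e : Sym2 V} (h : ∀ v ∈ e, v ∈ T) :
    ∑ v ∈ T, endSum e v = 2 := by
  induction e with
  | _ a b =>
    simp only [endSum_mk, Finset.sum_add_distrib, Finset.sum_ite_eq]
    rw [if_pos (h a (by simp)), if_pos (h b (by simp))]; rfl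

theorem sum_endSum_eq_zero {T : Finset V} {e : Sym2 V} (h : ∀ v ∈ e, v ∉ T) :
    ∑ v ∈ T, endSum e v = 0 :=
  Finset.sum_eq_zero fun v hv => endSum_eq_zero fun hve => h v hve hv

theorem rho_apply (e : Sym2 V) (v : V) : G.rho e v = G.sgn e * endSum e v := rfl

omit [DecidableEq V] in
theorem Proper.sgn_mul_self (hG : G.Proper) {e : Sym2 V} (he : e ∈ G.edges) :
    (G.sgn e : ℚ) * G.sgn e = 1 := by
  rcases hG e he with h | h <;> rw [h] <;> norm_num

namespace Walk

variable {l : ℕ} (W : G.Walk l)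

theorem endSum_edge (i : ℕ) (v : V) :
    endSum (W.edge i) v = (if W.vert i = v then 1 else 0) + (if W.vert (i + 1) = v then 1 else 0) :=
  endSum_mk _ _ _

theorem sum_alternating_endSum (n : ℕ) (v : V) :
    ∑ i ∈ range n, (-1 : ℤ) ^ i * endSum (W.edge i) v =
      (if W.vert 0 = v then 1 else 0) - (-1) ^ n * (if W.vert n = v then 1 else 0) := by
  induction n with
  | zero => simp
  | succ n ih => rw [Finset.sum_range_succ, ih, endSum_edge]; ring

/-- The function on edges which adds up the weights `w i` over the positions `i` of an edge
in a walk. -/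
def weight (w : ℕ → ℚ) (e : Sym2 V) : ℚ := ∑ i ∈ range l, if W.edge i = e then w i else 0

theorem sum_weight_mul (w : ℕ → ℚ) {X : Finset (Sym2 V)} (hX : ∀ i < l, W.edge i ∈ X)
    (φ : Sym2 V → ℚ) :
    ∑ e ∈ X, W.weight w e * φ e = ∑ i ∈ range l, w i * φ (W.edge i) := by
  simp only [weight, Finset.sum_mul]
  rw [Finset.sum_comm]
  refine Finset.sum_congr rfl fun i hi => ?_
  simp only [ite_mul, zero_mul]
  rw [Finset.sum_ite_eq, if_pos (hX i (Finset.mem_range.1 hi))]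

theorem weight_eq_zero (w : ℕ → ℚ) {e : Sym2 V} (he : ∀ i < l, W.edge i ≠ e) :
    W.weight w e = 0 :=
  Finset.sum_eq_zero fun i hi => if_neg (he i (Finset.mem_range.1 hi))

variable {W}

omit [DecidableEq V] in
theorem IsCycle.edge_inj (hW : W.IsCycle) {i j : ℕ} (hi : i < l) (hj : j < l)
    (h : W.edge i = W.edge j) : i = j := by
  obtain ⟨hcl, hpos, h2, hinj⟩ := hW
  have hcl : W.vert l = W.vert 0 := hcl
  rcases Sym2.eq_iff.1 h with ⟨h1, -⟩ | ⟨h1, h3⟩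
  · exact hinj i hi j hj h1
  · have hij : ∀ i j, i < l → j < l → W.vert i = W.vert (j + 1) →
        i = j + 1 ∨ i = 0 ∧ j + 1 = l := by
      intro i j hi hj h
      rcases Nat.lt_or_ge (j + 1) l with h' | h'
      · exact Or.inl (hinj _ hi _ h' h)
      · have : j + 1 = l := by omega
        rw [this, hcl] at h
        exact Or.inr ⟨hinj _ hi _ hpos h, this⟩
    have := hij i j hi hj h1
    have := hij j i hj hi h3.symm
    omega

theorem IsCycle.weight_edge (hW : W.IsCycle) (w : ℕ → ℚ) {i : ℕ} (hi : i < l) :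
    W.weight w (W.edge i) = w i := by
  rw [weight, Finset.sum_eq_single i]
  · rw [if_pos rfl]
  · intro j hj hji
    exact if_neg fun h => hji (hW.edge_inj (Finset.mem_range.1 hj) hi h)
  · intro h; exact absurd (Finset.mem_range.2 hi) h

/-- Each vertex of a cycle lies on exactly two consecutive edges. -/
theorem IsCycle.sum_mul_endSum_succ (hW : W.IsCycle) (y : ℕ → ℚ) {a : ℕ} (ha : a + 1 < l) :
    ∑ i ∈ range l, y i * endSum (W.edge i) (W.vert (a + 1)) = y a + y (a + 1) := by
  obtain ⟨hcl, hpos, h2, hinj⟩ := hW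
  have hcl : W.vert l = W.vert 0 := hcl
  have : ∀ i ∈ range l, y i * endSum (W.edge i) (W.vert (a + 1)) =
      (if i = a then y i else 0) + (if i = a + 1 then y i else 0) := by
    intro i hi
    have hi := Finset.mem_range.1 hi
    have e1 : W.vert i = W.vert (a + 1) ↔ i = a + 1 :=
      ⟨hinj _ hi _ ha, fun h => by rw [h]⟩
    have e2 : W.vert (i + 1) = W.vert (a + 1) ↔ i = a := by
      refine ⟨fun h => ?_, fun h => by rw [h]⟩
      rcases Nat.lt_or_ge (i + 1) l with h' | h'
      · have := hinj _ h' _ ha h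
        omega
      · have h3 : i + 1 = l := by omega
        rw [h3, hcl] at h
        have := hinj _ hpos _ ha h
        omega
    rw [endSum_edge]
    simp only [e1, e2]
    push_cast
    rw [mul_add, mul_ite, mul_ite, mul_one, mul_zero, add_comm]
  rw [Finset.sum_congr rfl this, Finset.sum_add_distrib, Finset.sum_ite_eq', Finset.sum_ite_eq',
    if_pos (by simp; omega), if_pos (by simpa using ha)]

theorem IsCycle.sum_mul_endSum_zero (hW : W.IsCycle) (y : ℕ → ℚ) :
    ∑ i ∈ range l, y i * endSum (W.edge i) (W.vert 0) = y (l - 1) + y 0 := by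
  obtain ⟨hcl, hpos, h2, hinj⟩ := hW
  have hcl : W.vert l = W.vert 0 := hcl
  have : ∀ i ∈ range l, y i * endSum (W.edge i) (W.vert 0) =
      (if i = l - 1 then y i else 0) + (if i = 0 then y i else 0) := by
    intro i hi
    have hi := Finset.mem_range.1 hi
    have e1 : W.vert i = W.vert 0 ↔ i = 0 :=
      ⟨hinj _ hi _ hpos, fun h => by rw [h]⟩
    have e2 : W.vert (i + 1) = W.vert 0 ↔ i = l - 1 := by
      refine ⟨fun h => ?_, fun h => by rw [h, Nat.sub_add_cancel hpos, hcl]⟩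
      rcases Nat.lt_or_ge (i + 1) l with h' | h'
      · have := hinj _ h' _ hpos h
        omega
      · omega
    rw [endSum_edge]
    simp only [e1, e2]
    push_cast
    rw [mul_add, mul_ite, mul_ite, mul_one, mul_zero, add_comm]
  rw [Finset.sum_congr rfl this, Finset.sum_add_distrib, Finset.sum_ite_eq', Finset.sum_ite_eq',
    if_pos (by simp; omega), if_pos (by simpa using hpos)]

theorem IsCycle.sum_endSum (hW : W.IsCycle) {a : ℕ} (ha : a < l) :
    ∑ i ∈ range l, endSum (W.edge i) (W.vert a) = 2 := by
  have : ∑ i ∈ range l, (1 : ℚ) * endSum (W.edge i) (W.vert a) = 2 := by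
    cases a with
    | zero => rw [hW.sum_mul_endSum_zero fun _ => 1]; norm_num
    | succ a => rw [hW.sum_mul_endSum_succ (fun _ => 1) ha]; norm_num
  simp only [one_mul] at this
  exact_mod_cast this

omit [DecidableEq V] in
theorem exists_vert_eq_of_mem_edge (hW : W.IsClosed) {i : ℕ} (hi : i < l) {v : V}
    (hv : v ∈ W.edge i) : ∃ j < l, W.vert j = v := by
  rcases Sym2.mem_iff.1 hv with rfl | rfl
  · exact ⟨i, hi, rfl⟩
  · rcases Nat.lt_or_ge (i + 1) l with h | h
    · exact ⟨i + 1, h, rfl⟩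
    · have : i + 1 = l := by omega
      exact ⟨0, by omega, by rw [this]; exact hW.symm⟩

/-- On a closed walk of odd length the edge vectors have a signed sum equal to twice any chosen
vertex. -/
theorem IsClosed.exists_signs (hW : W.IsClosed) (hl : Odd l) {a : ℕ} (ha : a < l) :
    ∃ ε : ℕ → ℤ, (∀ i, ε i = 1 ∨ ε i = -1) ∧
      ∀ v, ∑ i ∈ range l, ε i * endSum (W.edge i) v = 2 * (if W.vert a = v then 1 else 0) := by
  have hW : W.vert l = W.vert 0 := hW
  refine ⟨fun i => (-1) ^ a * if i < a then -(-1) ^ i else (-1) ^ i, fun i => ?_, fun v => ?_⟩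
  · rcases neg_one_pow_eq_or ℤ a with h | h <;> rcases neg_one_pow_eq_or ℤ i with h' | h' <;>
      simp only [h, h'] <;> split_ifs <;> simp
  · have h1 : ∑ i ∈ range l, (if i < a then (-1 : ℤ) ^ i * endSum (W.edge i) v else 0) =
        ∑ i ∈ range a, (-1 : ℤ) ^ i * endSum (W.edge i) v := by
      rw [← Finset.sum_filter]
      congr 1
      ext i; simp; omega
    have h2 : ∀ i ∈ range l,
        ((-1) ^ a * if i < a then -(-1) ^ i else (-1) ^ i) * endSum (W.edge i) v =
        (-1) ^ a * ((-1 : ℤ) ^ i * endSum (W.edge i) v -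
          2 * (if i < a then (-1 : ℤ) ^ i * endSum (W.edge i) v else 0)) := by
      intro i _
      split_ifs <;> ring
    rw [Finset.sum_congr rfl h2, ← Finset.mul_sum, Finset.sum_sub_distrib, ← Finset.mul_sum, h1,
      W.sum_alternating_endSum, W.sum_alternating_endSum, hW, hl.neg_one_pow]
    rcases neg_one_pow_eq_or ℤ a with h | h <;> rw [h] <;> ring

omit [DecidableEq V] in
theorem Alternating.sgn_edge (hW : W.Alternating) {i : ℕ} (hi : i < l) :
    G.sgn (W.edge i) = (-1) ^ i * G.sgn (W.edge 0) := by
  induction i with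
  | zero => simp
  | succ i ih => rw [hW i hi, ih (by omega)]; ring

theorem Alternating.exists_signs (hG : G.Proper) (hW : W.Alternating) :
    ∃ δ₁ δ₂ : ℤ, (δ₁ = 1 ∨ δ₁ = -1) ∧ (δ₂ = 1 ∨ δ₂ = -1) ∧
      ∀ v, ∑ i ∈ range l, G.rho (W.edge i) v =
        δ₁ * (if W.vert 0 = v then 1 else 0) + δ₂ * (if W.vert l = v then 1 else 0) := by
  rcases Nat.eq_zero_or_pos l with rfl | hl
  · exact ⟨1, -1, by simp, by simp, fun v => by
      simp only [Finset.range_zero, Finset.sum_empty]; ring⟩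
  set σ := G.sgn (W.edge 0) with hσ
  have hσ' : σ = 1 ∨ σ = -1 := hG _ (W.mem 0 hl)
  refine ⟨σ, -(σ * (-1) ^ l), hσ', ?_, fun v => ?_⟩
  · rcases neg_one_pow_eq_or ℤ l with h | h <;> rcases hσ' with h' | h' <;> simp [h, h']
  · have : ∀ i ∈ range l, G.rho (W.edge i) v = σ * ((-1) ^ i * endSum (W.edge i) v) := by
      intro i hi
      rw [rho_apply, hW.sgn_edge (Finset.mem_range.1 hi)]; ring
    rw [Finset.sum_congr rfl this, ← Finset.mul_sum, W.sum_alternating_endSum]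
    ring

end Walk

/-- A finite set of edges without leaves contains a cycle. -/
theorem exists_isCycle {H : Finset (Sym2 V)} (hHG : H ⊆ G.edges) (hne : H.Nonempty)
    (hH : ∀ e ∈ H, ∀ v ∈ e, e.IsDiag ∨ ∃ e' ∈ H, e' ≠ e ∧ v ∈ e') :
    ∃ (l : ℕ) (C : G.Walk l), C.IsCycle ∧ ∀ i < l, C.edge i ∈ H := by
  let D := {p : V × V // s(p.1, p.2) ∈ H}
  have hnext : ∀ p : D, ∃ q : D, q.1.1 = p.1.2 ∧
      (s(q.1.1, q.1.2) ≠ s(p.1.1, p.1.2) ∨ p.1.1 = p.1.2) := by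
    rintro ⟨⟨a, b⟩, hab⟩
    rcases hH _ hab b (by simp) with h | ⟨e', he', hne, hb⟩
    · obtain rfl : a = b := h
      exact ⟨⟨(a, a), hab⟩, rfl, Or.inr rfl⟩
    · obtain ⟨c, rfl⟩ := Sym2.mem_iff_exists.1 hb
      exact ⟨⟨(b, c), he'⟩, rfl, Or.inl hne⟩
  choose next hnext1 hnext2 using hnext
  obtain ⟨e₀, he₀⟩ := hne
  obtain ⟨p₀⟩ : Nonempty D := by
    induction e₀ with
    | _ a b => exact ⟨⟨(a, b), he₀⟩⟩
  let seq : ℕ → D := fun n => next^[n] p₀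
  have hseq : ∀ n, seq (n + 1) = next (seq n) := fun n => Function.iterate_succ_apply' _ _ _
  let x : ℕ → V := fun n => (seq n).1.1
  have hx : ∀ n, x (n + 1) = (seq n).1.2 := fun n => by
    change (seq (n + 1)).1.1 = _
    rw [hseq, hnext1]
  have hxH : ∀ n, s(x n, x (n + 1)) ∈ H := fun n => by rw [hx]; exact (seq n).2
  have hback : ∀ n, s(x (n + 1), x (n + 2)) ≠ s(x n, x (n + 1)) ∨ x n = x (n + 1) := fun n => by
    have := hnext2 (seq n)
    rw [← hseq] at this
    rw [hx n, hx (n + 1)]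
    rw [show (seq (n + 1)).1.1 = (seq n).1.2 from hx n] at this
    exact this
  have hrep : ∃ d, 0 < d ∧ ∃ i, x i = x (i + d) := by
    have hmaps : Set.MapsTo x Set.univ (H.biUnion fun e => e.toFinset : Finset V) := by
      intro n _
      simp only [Finset.coe_biUnion, Set.mem_iUnion]
      exact ⟨_, hxH n, by simp⟩
    obtain ⟨i, -, j, -, hij, h⟩ :=
      Set.infinite_univ.exists_ne_map_eq_of_mapsTo hmaps (Finset.finite_toSet _)
    rcases Nat.lt_or_gt_of_ne hij with h' | h'
    · exact ⟨j - i, by omega, i, by rw [h]; congr 1; omega⟩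
    · exact ⟨i - j, by omega, j, by rw [← h]; congr 1; omega⟩
  classical
  obtain ⟨hd, i₀, hi₀⟩ := Nat.find_spec hrep
  have hmin : ∀ d, 0 < d → (∃ i, x i = x (i + d)) → Nat.find hrep ≤ d :=
    fun d h1 h2 => Nat.find_min' hrep ⟨h1, h2⟩
  generalize Nat.find hrep = d at hd hi₀ hmin
  refine ⟨d, ⟨fun n => x (i₀ + n), fun n _ => hHG (hxH _)⟩, ⟨hi₀.symm, hd, ?_, ?_⟩,
    fun n _ => hxH _⟩
  · rintro rfl
    rcases hback i₀ with h | h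
    · apply h
      rw [← hi₀, Sym2.eq_swap]
    · have := hmin 1 one_pos ⟨i₀, h⟩
      omega
  · have key : ∀ a b, a < b → b < d → x (i₀ + a) ≠ x (i₀ + b) := by
      intro a b hab hb h
      have := hmin (b - a) (by omega) ⟨i₀ + a, by rw [h]; congr 1; omega⟩
      omega
    intro a ha b hb h
    by_contra hab
    rcases Nat.lt_or_gt_of_ne hab with h' | h'
    exacts [key a b h' hb h, key b a h' ha h.symm]

end SignedGraph

namespace SignedGraph

/-- The integers as a subring of the rationals. -/
abbrev integers : Subring ℚ := (Int.castRingHom ℚ).range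

theorem exists_eq_add_half {q : ℚ} (hq : q ∉ integers) (h2 : 2 * q ∈ integers) :
    ∃ m : ℤ, q = m + 1 / 2 := by
  obtain ⟨k, hk⟩ := h2
  have hk : (k : ℚ) = 2 * q := hk
  rcases Int.even_or_odd' k with ⟨m, rfl | rfl⟩
  · refine absurd ⟨m, ?_⟩ hq
    push_cast at hk
    change (m : ℚ) = q
    linarith
  · refine ⟨m, ?_⟩
    push_cast at hk
    linarith

theorem half_le_of_eq_add_half {q : ℚ} (h0 : 0 ≤ q) (h : ∃ m : ℤ, q = m + 1 / 2) : 1 / 2 ≤ q := by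
  obtain ⟨m, rfl⟩ := h
  have h1 : ((-1 : ℤ) : ℚ) < m := by push_cast; linarith
  have h2 : (0 : ℚ) ≤ m := by exact_mod_cast Int.add_one_le_iff.2 (Int.cast_lt.1 h1)
  linarith

theorem half_notMem_integers : (1 / 2 : ℚ) ∉ integers := by
  rintro ⟨k, hk⟩
  have hk : (k : ℚ) = 1 / 2 := hk
  have : ((2 * k : ℤ) : ℚ) = (1 : ℤ) := by push_cast; linarith
  have : 2 * k = 1 := by exact_mod_cast this
  omega

variable {V : Type} [DecidableEq V] {G : SignedGraph V}

theorem SameComponent.of_mem {u v w : V} (h : G.SameComponent u v) {e : Sym2 V} (he : e ∈ G.edges)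
    (hv : v ∈ e) (hw : w ∈ e) : G.SameComponent u w := by
  by_cases hvw : v = w
  · exact hvw ▸ h
  obtain rfl : e = s(v, w) := (Sym2.mem_and_mem_iff hvw).1 ⟨hv, hw⟩
  obtain ⟨n, W, h0, hn⟩ := h
  refine ⟨n + 1, ⟨fun i => if i ≤ n then W.vert i else w, fun i hi => ?_⟩, ?_, ?_⟩
  · rcases Nat.lt_or_ge i n with h | h
    · simp only [if_pos h.le, if_pos (show i + 1 ≤ n from h)]
      exact W.mem i h
    · obtain rfl : i = n := by omega
      simpa [hn] using he
  · simpa using h0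
  · simp

omit [DecidableEq V] in
theorem Walk.sameComponent {l : ℕ} (W : G.Walk l) {a : ℕ} (ha : a ≤ l) :
    G.SameComponent (W.vert 0) (W.vert a) :=
  ⟨a, ⟨W.vert, fun i hi => W.mem i (by omega)⟩, rfl, rfl⟩

theorem Walk.IsCycle.sum_eq_sum_edge {l : ℕ} {C : G.Walk l} (hC : C.IsCycle) {M : Type*}
    [AddCommMonoid M] {X : Finset (Sym2 V)} (hX : ∀ i < l, C.edge i ∈ X) {φ : Sym2 V → M}
    (hφ : ∀ e ∈ X, (∀ i < l, C.edge i ≠ e) → φ e = 0) :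
    ∑ e ∈ X, φ e = ∑ i ∈ range l, φ (C.edge i) := by
  rw [← Finset.sum_image (f := φ) (g := C.edge) (s := range l) fun i hi j hj h =>
    hC.edge_inj (by simpa using hi) (by simpa using hj) h]
  refine (Finset.sum_subset (fun e he => ?_) fun e he hne => hφ e he fun i hi h => hne ?_).symm
  · obtain ⟨i, hi, rfl⟩ := Finset.mem_image.1 he
    exact hX i (Finset.mem_range.1 hi)
  · exact Finset.mem_image.2 ⟨i, Finset.mem_range.2 hi, h⟩

/-- The nonnegative rational combinations of edge vectors which represent `z`. -/
def IsRep (G : SignedGraph V) (z : V → ℤ) (r : Sym2 V → ℚ) : Prop :=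
  (∀ e ∈ G.edges, 0 ≤ r e) ∧ ∀ v, (z v : ℚ) = ∑ e ∈ G.edges, r e * G.rho e v

open Classical in
/-- The edges with a non-integral coefficient. -/
noncomputable def fracSupport (G : SignedGraph V) (r : Sym2 V → ℚ) : Finset (Sym2 V) :=
  {e ∈ G.edges | r e ∉ integers}

omit [DecidableEq V] in
theorem mem_fracSupport {r : Sym2 V → ℚ} {e : Sym2 V} :
    e ∈ G.fracSupport r ↔ e ∈ G.edges ∧ r e ∉ integers := by
  simp only [fracSupport, Finset.mem_filter]

/-- A representation with the least possible number of non-integral coefficients. -/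
structure IsMinRep (G : SignedGraph V) (z : V → ℤ) (r : Sym2 V → ℚ) : Prop where
  isRep : G.IsRep z r
  le_card : ∀ r', G.IsRep z r' → #(G.fracSupport r) ≤ #(G.fracSupport r')

theorem IsRep.exists_isMinRep {z : V → ℤ} {r : Sym2 V → ℚ} (hr : G.IsRep z r) :
    ∃ r, G.IsMinRep z r := by
  obtain ⟨r', hr', hmin⟩ :=
    (measure fun r => #(G.fracSupport r)).wf.has_min {r | G.IsRep z r} ⟨r, hr⟩
  exact ⟨r', hr', fun r'' h => not_lt.1 (hmin r'' h)⟩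

namespace IsMinRep

variable {z : V → ℤ} {r : Sym2 V → ℚ}

/-- No edge coefficient can be made integral by adding a relation which keeps nonnegativity and
does not destroy integrality elsewhere. -/
theorem mem_integers_of_add (h : G.IsMinRep z r) {t : Sym2 V → ℚ}
    (ht : ∀ v, ∑ e ∈ G.edges, t e * G.rho e v = 0) (hnn : ∀ e ∈ G.edges, 0 ≤ r e + t e)
    (hint : ∀ e ∈ G.edges, r e ∈ integers → t e ∈ integers) {e : Sym2 V} (he : e ∈ G.edges)
    (het : r e + t e ∈ integers) : r e ∈ integers := by
  by_contra hre
  have hrep : G.IsRep z fun e => r e + t e := by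
    refine ⟨hnn, fun v => ?_⟩
    simp only [add_mul, Finset.sum_add_distrib, ht v, add_zero]
    exact h.isRep.2 v
  refine (h.le_card _ hrep).not_gt (Finset.card_lt_card ?_)
  refine Finset.ssubset_iff_of_subset (fun e' he' => ?_) |>.2
    ⟨e, mem_fracSupport.2 ⟨he, hre⟩, fun h' => (mem_fracSupport.1 h').2 het⟩
  rw [mem_fracSupport] at he' ⊢
  exact ⟨he'.1, fun h' => he'.2 (add_mem h' (hint _ he'.1 h'))⟩

/-- The edge vectors with non-integral coefficients are linearly independent. -/
theorem eq_zero_of_sum_eq_zero (h : G.IsMinRep z r) {t : Sym2 V → ℚ}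
    (ht : ∀ v, ∑ e ∈ G.edges, t e * G.rho e v = 0) (hint : ∀ e ∈ G.edges, r e ∈ integers → t e = 0)
    {e : Sym2 V} (he : e ∈ G.edges) : t e = 0 := by
  have key : ∀ t : Sym2 V → ℚ, (∀ v, ∑ e ∈ G.edges, t e * G.rho e v = 0) →
      (∀ e ∈ G.edges, r e ∈ integers → t e = 0) → ∀ e ∈ G.edges, 0 ≤ t e := by
    intro t ht hint e₀ he₀
    by_contra! hneg
    obtain ⟨e₁, he₁, hmin⟩ := Finset.exists_min_image {e ∈ G.edges | t e < 0}
      (fun e => Int.fract (r e) / -t e) ⟨e₀, Finset.mem_filter.2 ⟨he₀, hneg⟩⟩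
    obtain ⟨he₁, ht₁⟩ := Finset.mem_filter.1 he₁
    set c := Int.fract (r e₁) / -t e₁ with hc
    have hc0 : 0 ≤ c := div_nonneg (Int.fract_nonneg _) (by linarith)
    refine ht₁.ne (hint e₁ he₁ (h.mem_integers_of_add (t := fun e => c * t e) ?_ ?_ ?_ he₁ ?_))
    · intro v
      simp only [mul_assoc, ← Finset.mul_sum, ht v, mul_zero]
    · intro e he
      rcases le_or_gt 0 (t e) with h' | h'
      · exact add_nonneg (h.isRep.1 e he) (mul_nonneg hc0 h')
      · have h1 := hmin e (Finset.mem_filter.2 ⟨he, h'⟩)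
        rw [le_div_iff₀ (by linarith)] at h1
        have h2 := Int.self_sub_fract (r e)
        have h3 : (0 : ℚ) ≤ ⌊r e⌋ := by exact_mod_cast Int.floor_nonneg.2 (h.isRep.1 e he)
        linarith
    · intro e he hr
      simp only [hint e he hr, mul_zero, zero_mem]
    · refine ⟨⌊r e₁⌋, ?_⟩
      have : c * t e₁ = -Int.fract (r e₁) := by
        rw [hc, div_neg, neg_mul, div_mul_cancel₀ _ ht₁.ne]
      simp only [this, ← sub_eq_add_neg, Int.self_sub_fract]
      rfl
  have h1 := key t ht hint e he
  have h2 := key (fun e => -t e) (fun v => by simp [ht v])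
    (fun e he hr => by simp [hint e he hr]) e he
  linarith

theorem sum_fracSupport_mem (h : G.IsMinRep z r) (v : V) :
    ∑ e ∈ G.fracSupport r, r e * G.rho e v ∈ integers := by
  classical
  have h1 := h.isRep.2 v
  rw [← Finset.sum_filter_add_sum_filter_not _ (fun e => r e ∉ integers)] at h1
  have h2 : ∑ e ∈ G.fracSupport r, r e * G.rho e v =
      z v - ∑ e ∈ G.edges with ¬ r e ∉ integers, r e * G.rho e v := by
    rw [h1, add_sub_cancel_right]
    rfl
  rw [h2]
  refine sub_mem (intCast_mem _ _) (sum_mem fun e he => mul_mem ?_ (intCast_mem _ _))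
  simpa using (Finset.mem_filter.1 he).2

theorem exists_ne (hG : G.Proper) (h : G.IsMinRep z r) {e : Sym2 V} (he : e ∈ G.fracSupport r)
    {v : V} (hv : v ∈ e) (hd : ¬ e.IsDiag) : ∃ e' ∈ G.fracSupport r, e' ≠ e ∧ v ∈ e' := by
  by_contra! hne
  have h1 := h.sum_fracSupport_mem v
  obtain ⟨heG, her⟩ := mem_fracSupport.1 he
  rw [Finset.sum_eq_single_of_mem e he, rho_apply, endSum_of_not_isDiag hv hd, mul_one] at h1
  · have h2 := mul_mem h1 (intCast_mem integers (G.sgn e))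
    rw [mul_assoc, hG.sgn_mul_self heG, mul_one] at h2
    exact her h2
  · intro e' he' hne'
    rw [rho_apply, endSum_eq_zero (hne e' he' hne')]
    simp

theorem two_le_sum_endSum (hG : G.Proper) (h : G.IsMinRep z r) {e : Sym2 V}
    (he : e ∈ G.fracSupport r) {v : V} (hv : v ∈ e) :
    2 ≤ ∑ e' ∈ G.fracSupport r, endSum e' v := by
  by_cases hd : e.IsDiag
  · rw [← endSum_of_isDiag hv hd]
    exact Finset.single_le_sum (f := fun e => endSum e v) (fun e _ => endSum_nonneg e v) he
  · obtain ⟨e', he', hne, hv'⟩ := h.exists_ne hG he hv hd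
    have h1 : ∑ e₁ ∈ {e', e}, endSum e₁ v ≤ ∑ e₁ ∈ G.fracSupport r, endSum e₁ v :=
      Finset.sum_le_sum_of_subset_of_nonneg
        (by simp [Finset.insert_subset_iff, he, he']) fun e _ _ => endSum_nonneg e v
    rw [Finset.sum_pair hne] at h1
    linarith [one_le_endSum hv, one_le_endSum hv']

theorem card_fracSupport_le (h : G.IsMinRep z r) :
    #(G.fracSupport r) ≤ #((G.fracSupport r).biUnion Sym2.toFinset) := by
  set F := G.fracSupport r with hF
  set T := F.biUnion Sym2.toFinset with hT
  have hli : LinearIndependent ℚ fun (e : F) (v : T) => (G.rho e v : ℚ) := by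
    rw [Fintype.linearIndependent_iff]
    intro g hg e
    let t : Sym2 V → ℚ := fun e => if he : e ∈ F then g ⟨e, he⟩ else 0
    have htg : ∀ e : F, t e = g e := fun e => dif_pos e.2
    rw [← htg]
    refine h.eq_zero_of_sum_eq_zero (t := t) (fun v => ?_)
      (fun e _ hr => dif_neg fun h' => (mem_fracSupport.1 h').2 hr) (mem_fracSupport.1 e.2).1
    have h1 : ∑ e ∈ F, t e * G.rho e v = ∑ e ∈ G.edges, t e * G.rho e v :=
      Finset.sum_subset (fun e he => (mem_fracSupport.1 he).1) fun e _ he => by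
        simp only [t, dif_neg he, zero_mul]
    rw [← h1]
    by_cases hv : v ∈ T
    · rw [← Finset.sum_coe_sort]
      have h2 := congrFun hg ⟨v, hv⟩
      simpa [htg] using h2
    · refine Finset.sum_eq_zero fun e he => ?_
      rw [rho_apply, endSum_eq_zero fun hve =>
        hv (Finset.mem_biUnion.2 ⟨e, he, by simpa using hve⟩)]
      simp
  simpa using hli.fintype_card_le_finrank

theorem sum_endSum_eq_two (hG : G.Proper) (h : G.IsMinRep z r) {e : Sym2 V}
    (he : e ∈ G.fracSupport r) {v : V} (hv : v ∈ e) :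
    ∑ e' ∈ G.fracSupport r, endSum e' v = 2 := by
  have hcard := h.card_fracSupport_le
  set F := G.fracSupport r with hF
  set T := F.biUnion Sym2.toFinset with hT
  have hmem : ∀ {v}, v ∈ T ↔ ∃ e ∈ F, v ∈ e := by simp [hT]
  have hle : ∀ v ∈ T, (2 : ℤ) ≤ ∑ e' ∈ F, endSum e' v := fun v hv => by
    obtain ⟨e, he, hve⟩ := hmem.1 hv
    exact h.two_le_sum_endSum hG he hve
  have hsum : ∑ v ∈ T, ∑ e' ∈ F, endSum e' v = 2 * #F := by
    rw [Finset.sum_comm, Finset.sum_congr rfl fun e he =>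
      sum_endSum fun v hv => hmem.2 ⟨e, he, hv⟩]
    simp [mul_comm]
  have heq : ∑ v ∈ T, (2 : ℤ) = ∑ v ∈ T, ∑ e' ∈ F, endSum e' v := by
    refine le_antisymm (Finset.sum_le_sum hle) ?_
    rw [hsum, Finset.sum_const, nsmul_eq_mul, mul_comm]
    gcongr
  exact ((Finset.sum_eq_sum_iff_of_le hle).1 heq v (hmem.2 ⟨e, he, hv⟩)).symm

section Cycle

variable {l : ℕ} {C : G.Walk l}

/-- A cycle in the non-integral edges meets no other non-integral edge. -/
theorem exists_edge_eq (hG : G.Proper) (h : G.IsMinRep z r) (hC : C.IsCycle)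
    (hCF : ∀ i < l, C.edge i ∈ G.fracSupport r) {e : Sym2 V} (he : e ∈ G.fracSupport r) {a : ℕ}
    (ha : a < l) (hv : C.vert a ∈ e) : ∃ i < l, C.edge i = e := by
  by_contra! hne
  have h1 := h.sum_endSum_eq_two hG he hv
  rw [← Finset.add_sum_erase _ _ he] at h1
  have h2 : ∑ i ∈ range l, endSum (C.edge i) (C.vert a) ≤
      ∑ e' ∈ (G.fracSupport r).erase e, endSum e' (C.vert a) := by
    rw [← Finset.sum_image (f := fun e => endSum e (C.vert a)) (g := C.edge) (s := range l)
      fun i hi j hj h => hC.edge_inj (by simpa using hi) (by simpa using hj) h]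
    refine Finset.sum_le_sum_of_subset_of_nonneg (fun e' he' => ?_) fun e _ _ => endSum_nonneg e _
    obtain ⟨i, hi, rfl⟩ := Finset.mem_image.1 he'
    have hi := Finset.mem_range.1 hi
    exact Finset.mem_erase.2 ⟨hne i hi, hCF i hi⟩
  rw [hC.sum_endSum ha] at h2
  linarith [one_le_endSum hv]

theorem odd_length (hG : G.Proper) (h : G.IsMinRep z r) (hC : C.IsCycle)
    (hCF : ∀ i < l, C.edge i ∈ G.fracSupport r) : Odd l := by
  by_contra hl
  rw [Nat.not_odd_iff_even] at hl
  have hE : ∀ i < l, C.edge i ∈ G.edges := C.mem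
  have h0 := h.eq_zero_of_sum_eq_zero (t := C.weight fun i => (-1) ^ i * G.sgn (C.edge i))
    (fun v => ?_) (fun e _ hr => C.weight_eq_zero _ fun i hi h' => ?_) (hE 0 hC.2.1)
  · rw [hC.weight_edge _ hC.2.1, pow_zero, one_mul] at h0
    have := hG.sgn_mul_self (hE 0 hC.2.1)
    rw [h0] at this
    norm_num at this
  · rw [C.sum_weight_mul _ hE]
    have h1 : ∀ i ∈ range l, (-1 : ℚ) ^ i * G.sgn (C.edge i) * G.rho (C.edge i) v =
        (((-1) ^ i * endSum (C.edge i) v : ℤ) : ℚ) := by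
      intro i hi
      have := hG.sgn_mul_self (hE i (Finset.mem_range.1 hi))
      rw [rho_apply]
      push_cast
      linear_combination ((-1 : ℚ) ^ i * endSum (C.edge i) v) * this
    rw [Finset.sum_congr rfl h1, ← Int.cast_sum, C.sum_alternating_endSum, hl.neg_one_pow,
      show C.vert l = C.vert 0 from hC.1]
    simp
  · exact (mem_fracSupport.1 (h' ▸ hCF i hi)).2 hr

theorem sum_edge_mem (hG : G.Proper) (h : G.IsMinRep z r) (hC : C.IsCycle)
    (hCF : ∀ i < l, C.edge i ∈ G.fracSupport r) {a : ℕ} (ha : a < l) :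
    ∑ i ∈ range l, r (C.edge i) * G.sgn (C.edge i) * endSum (C.edge i) (C.vert a) ∈ integers := by
  have h1 := h.sum_fracSupport_mem (C.vert a)
  rw [hC.sum_eq_sum_edge hCF] at h1
  · simpa only [rho_apply, Int.cast_mul, mul_assoc] using h1
  · intro e he hne
    rw [rho_apply, endSum_eq_zero]
    · simp
    · intro hv
      obtain ⟨i, hi, h'⟩ := h.exists_edge_eq hG hC hCF he ha hv
      exact hne i hi h'

theorem exists_edge_eq_add_half (hG : G.Proper) (h : G.IsMinRep z r) (hC : C.IsCycle)
    (hCF : ∀ i < l, C.edge i ∈ G.fracSupport r) {a : ℕ} (ha : a < l) :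
    ∃ m : ℤ, r (C.edge a) = m + 1 / 2 := by
  set y : ℕ → ℚ := fun i => r (C.edge i) * G.sgn (C.edge i) with hy
  have hl := h.odd_length hG hC hCF
  have hind : ∀ a < l, y a - (-1) ^ a * y 0 ∈ integers := by
    intro a
    induction a with
    | zero => intro _; simp
    | succ a ih =>
      intro ha
      have h1 := h.sum_edge_mem hG hC hCF ha
      rw [hC.sum_mul_endSum_succ y ha] at h1
      convert sub_mem h1 (ih (by omega)) using 1
      ring
  have h0 : 2 * y 0 ∈ integers := by
    have h1 := h.sum_edge_mem hG hC hCF hC.2.1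
    rw [hC.sum_mul_endSum_zero y] at h1
    have h2 := hind (l - 1) (Nat.sub_lt hC.2.1 one_pos)
    rw [(Nat.Odd.sub_odd hl odd_one).neg_one_pow] at h2
    convert sub_mem h1 h2 using 1
    ring
  have hya : 2 * y a ∈ integers := by
    have h1 : (-1 : ℚ) ^ a ∈ integers := pow_mem (neg_mem (one_mem _)) a
    convert add_mem (mul_mem h1 h0) (mul_mem (intCast_mem integers 2) (hind a ha)) using 1
    push_cast; ring
  obtain ⟨hE, hr⟩ := mem_fracSupport.1 (hCF a ha)
  refine exists_eq_add_half hr ?_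
  convert mul_mem hya (intCast_mem integers (G.sgn (C.edge a))) using 1
  linear_combination (-2 * r (C.edge a)) * hG.sgn_mul_self hE

end Cycle

theorem sum_filter_sgn_mem (h : G.IsMinRep z r) {b : Sym2 V → ℤ}
    (hb : ∀ v, z v = ∑ e ∈ G.edges, b e * G.rho e v) (K : V → Prop)
    (hK : ∀ e ∈ G.edges, ∀ v ∈ e, ∀ w ∈ e, K v → K w)
    [DecidablePred fun e : Sym2 V => ∃ v ∈ e, K v] :
    ∑ e ∈ G.fracSupport r with ∃ v ∈ e, K v, r e * G.sgn e ∈ integers := by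
  classical
  set T := {v ∈ G.edges.biUnion Sym2.toFinset | K v} with hT
  have hchi : ∀ e ∈ G.edges, ∑ v ∈ T, endSum e v = if ∃ v ∈ e, K v then 2 else 0 := by
    intro e he
    split_ifs with hc
    · obtain ⟨v, hv, hKv⟩ := hc
      refine sum_endSum fun w hw => Finset.mem_filter.2 ⟨?_, hK e he v hv w hw hKv⟩
      exact Finset.mem_biUnion.2 ⟨e, he, by simpa using hw⟩
    · exact sum_endSum_eq_zero fun v hv hvT => hc ⟨v, hv, (Finset.mem_filter.1 hvT).2⟩
  have hsum : ∀ c : Sym2 V → ℚ, (∀ v, (z v : ℚ) = ∑ e ∈ G.edges, c e * G.rho e v) →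
      ∑ v ∈ T, (z v : ℚ) = 2 * ∑ e ∈ G.edges with ∃ v ∈ e, K v, c e * G.sgn e := by
    intro c hc
    rw [Finset.sum_congr rfl fun v _ => hc v, Finset.sum_comm, Finset.sum_filter, Finset.mul_sum]
    refine Finset.sum_congr rfl fun e he => ?_
    simp only [rho_apply, Int.cast_mul, ← Finset.mul_sum, ← Int.cast_sum, hchi e he]
    split_ifs <;> push_cast <;> ring
  have h1 := hsum r h.isRep.2
  rw [hsum (fun e => (b e : ℚ)) fun v => by rw [hb v]; push_cast; rfl] at h1
  have h2 := mul_left_cancel₀ two_ne_zero h1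
  rw [← Finset.sum_filter_add_sum_filter_not {e ∈ G.edges | ∃ v ∈ e, K v}
    (fun e => r e ∉ integers) fun e => r e * (G.sgn e : ℚ)] at h2
  have h3 : {e ∈ {e ∈ G.edges | ∃ v ∈ e, K v} | r e ∉ integers} =
      {e ∈ G.fracSupport r | ∃ v ∈ e, K v} := by
    ext e
    simp only [Finset.mem_filter, mem_fracSupport]
    tauto
  rw [h3, ← sub_eq_iff_eq_add] at h2
  rw [← h2]
  refine sub_mem (sum_mem fun e _ => mul_mem (intCast_mem _ _) (intCast_mem _ _))
    (sum_mem fun e he => mul_mem ?_ (intCast_mem _ _))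
  simpa using (Finset.mem_filter.1 he).2

/-- The non-integral edges contain a second cycle in the component of a given one. -/
theorem exists_disjointCycles (hG : G.Proper) (h : G.IsMinRep z r) {b : Sym2 V → ℤ}
    (hb : ∀ v, z v = ∑ e ∈ G.edges, b e * G.rho e v) {l : ℕ} {C : G.Walk l} (hC : C.IsCycle)
    (hCF : ∀ i < l, C.edge i ∈ G.fracSupport r) :
    ∃ (l' : ℕ) (C' : G.Walk l'), C'.IsCycle ∧ (∀ i < l', C'.edge i ∈ G.fracSupport r) ∧
      DisjointCycles C C' ∧ G.SameComponent (C.vert 0) (C'.vert 0) := by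
  classical
  set F := G.fracSupport r with hF
  have hFE : ∀ e ∈ F, e ∈ G.edges := fun e he => (mem_fracSupport.1 he).1
  set H := {e ∈ F | (∃ v ∈ e, G.SameComponent (C.vert 0) v) ∧ ∀ i < l, C.edge i ≠ e} with hH
  have hHF : ∀ e ∈ H, e ∈ F := fun e he => (Finset.mem_filter.1 he).1
  have hne : H.Nonempty := by
    by_contra hempty
    rw [Finset.not_nonempty_iff_eq_empty] at hempty
    have h1 := h.sum_filter_sgn_mem hb (G.SameComponent (C.vert 0))
      fun e he v hv w hw hKv => hKv.of_mem he hv hw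
    rw [hC.sum_eq_sum_edge] at h1
    · have h2 : ∑ i ∈ range l, (r (C.edge i) * G.sgn (C.edge i) - 1 / 2) ∈ integers := by
        refine sum_mem fun i hi => ?_
        have hi := Finset.mem_range.1 hi
        obtain ⟨m, hm⟩ := h.exists_edge_eq_add_half hG hC hCF hi
        rcases hG _ (C.mem i hi) with h' | h'
        · have h' : G.sgn (C.edge i) = 1 := h'
          rw [hm, h']
          convert intCast_mem integers m using 1
          push_cast; ring
        · have h' : G.sgn (C.edge i) = -1 := h'
          rw [hm, h']
          convert intCast_mem integers (-m - 1) using 1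
          push_cast; ring
      obtain ⟨m, rfl⟩ := h.odd_length hG hC hCF
      rw [Finset.sum_sub_distrib, Finset.sum_const, Finset.card_range] at h2
      refine half_notMem_integers ?_
      convert sub_mem (sub_mem h1 h2) (intCast_mem integers m) using 1
      simp; ring
    · intro i hi
      exact Finset.mem_filter.2 ⟨hCF i hi, C.vert i, Sym2.mem_mk_left _ _, C.sameComponent hi.le⟩
    · intro e he hne
      obtain ⟨he, hc⟩ := Finset.mem_filter.1 he
      have : e ∈ H := Finset.mem_filter.2 ⟨he, hc, hne⟩
      simp [hempty] at this
  have hleaf : ∀ e ∈ H, ∀ v ∈ e, e.IsDiag ∨ ∃ e' ∈ H, e' ≠ e ∧ v ∈ e' := by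
    intro e he v hv
    obtain ⟨heF, ⟨w, hw, hKw⟩, hCe⟩ := Finset.mem_filter.1 he
    refine or_iff_not_imp_left.2 fun hd => ?_
    obtain ⟨e', he', hne', hv'⟩ := h.exists_ne hG heF hv hd
    refine ⟨e', Finset.mem_filter.2 ⟨he', ⟨v, hv', hKw.of_mem (hFE e heF) hw hv⟩, ?_⟩, hne', hv'⟩
    rintro i hi rfl
    obtain ⟨j, hj, rfl⟩ := Walk.exists_vert_eq_of_mem_edge hC.1 hi hv'
    obtain ⟨i', hi', h'⟩ := h.exists_edge_eq hG hC hCF heF hj hv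
    exact hCe i' hi' h'
  obtain ⟨l', C', hC', hC'H⟩ := exists_isCycle (G := G) (fun e he => hFE e (hHF e he)) hne hleaf
  refine ⟨l', C', hC', fun i hi => hHF _ (hC'H i hi), fun i hi j hj hij => ?_, ?_⟩
  · obtain ⟨i', hi', h'⟩ := h.exists_edge_eq hG hC hCF (hHF _ (hC'H j hj)) hi
      (hij ▸ Sym2.mem_mk_left _ _)
    exact (Finset.mem_filter.1 (hC'H j hj)).2.2 i' hi' h'
  · obtain ⟨he, ⟨v, hv, hKv⟩, -⟩ := Finset.mem_filter.1 (hC'H 0 hC'.2.1)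
    exact hKv.of_mem (hFE _ he) hv (Sym2.mem_mk_left _ _)

end IsMinRep

end SignedGraph

namespace SignedGraph

variable {V : Type} [DecidableEq V] {G : SignedGraph V} {z : V → ℤ} {r : Sym2 V → ℚ}

theorem Walk.IsClosed.sum_half_sgn_mul_rho {l : ℕ} {C : G.Walk l} (hG : G.Proper) (δ : ℤ)
    {ε : ℕ → ℤ} {u : V}
    (hε : ∀ v, ∑ i ∈ range l, ε i * endSum (C.edge i) v = 2 * (if u = v then 1 else 0)) (v : V) :
    ∑ i ∈ range l, (-δ / 2 * (ε i * G.sgn (C.edge i)) : ℚ) * G.rho (C.edge i) v =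
      -δ * (if u = v then 1 else 0) := by
  have h1 : ∀ i ∈ range l, (-δ / 2 * (ε i * G.sgn (C.edge i)) : ℚ) * G.rho (C.edge i) v =
      -δ / 2 * ((ε i * endSum (C.edge i) v : ℤ) : ℚ) := by
    intro i hi
    have := hG.sgn_mul_self (C.mem i (Finset.mem_range.1 hi))
    change (G.sgn (C.edge i) : ℚ) * G.sgn (C.edge i) = 1 at this
    rw [rho_apply]
    push_cast
    linear_combination (-δ / 2 * ε i * endSum (C.edge i) v : ℚ) * this
  rw [Finset.sum_congr rfl h1, ← Finset.mul_sum, ← Int.cast_sum, hε]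
  split_ifs <;> push_cast <;> ring

omit [DecidableEq V] in
theorem half_sgn_mul_eq (hG : G.Proper) {δ ε : ℤ} (hδ : δ = 1 ∨ δ = -1) (hε : ε = 1 ∨ ε = -1)
    {e : Sym2 V} (he : e ∈ G.edges) :
    (-δ / 2 * (ε * G.sgn e) : ℚ) = 1 / 2 ∨ (-δ / 2 * (ε * G.sgn e) : ℚ) = -(1 / 2) := by
  rcases hδ with rfl | rfl <;> rcases hε with rfl | rfl <;> rcases hG e he with h | h <;>
    rw [h] <;> norm_num

/-- Under the odd cycle condition a representation with as few non-integral coefficients as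
possible is integral. -/
theorem IsMinRep.fracSupport_eq_empty (hG : G.Proper) (hocc : G.OddCycleCondition)
    (h : G.IsMinRep z r) {b : Sym2 V → ℤ} (hb : ∀ v, z v = ∑ e ∈ G.edges, b e * G.rho e v) :
    G.fracSupport r = ∅ := by
  by_contra hne
  obtain ⟨l, C, hC, hCF⟩ := exists_isCycle (G := G) (fun e he => (mem_fracSupport.1 he).1)
    (Finset.nonempty_iff_ne_empty.2 hne)
    fun e he v hv => or_iff_not_imp_left.2 fun hd => h.exists_ne hG he hv hd
  obtain ⟨l', C', hC', hCF', hdisj, hcomp⟩ := h.exists_disjointCycles hG hb hC hCF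
  obtain ⟨p, P, -, hP, ⟨a, ha, hPa⟩, ⟨a', ha', hPa'⟩⟩ := hocc l l' C C' hC hC'
    (h.odd_length hG hC hCF) (h.odd_length hG hC' hCF') hdisj hcomp
  obtain ⟨ε, hε, hεsum⟩ := hC.1.exists_signs (h.odd_length hG hC hCF) ha
  obtain ⟨ε', hε', hεsum'⟩ := hC'.1.exists_signs (h.odd_length hG hC' hCF') ha'
  obtain ⟨δ, δ', hδ, hδ', hδsum⟩ := hP.exists_signs hG
  set w : ℕ → ℚ := fun i => -δ / 2 * (ε i * G.sgn (C.edge i)) with hw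
  set w' : ℕ → ℚ := fun i => -δ' / 2 * (ε' i * G.sgn (C'.edge i)) with hw'
  have hCE : ∀ i < l, C.edge i ∈ G.edges := C.mem
  have hCE' : ∀ i < l', C'.edge i ∈ G.edges := C'.mem
  have hwv : ∀ i < l, w i = 1 / 2 ∨ w i = -(1 / 2) := fun i hi =>
    half_sgn_mul_eq hG hδ (hε i) (hCE i hi)
  have hwv' : ∀ i < l', w' i = 1 / 2 ∨ w' i = -(1 / 2) := fun i hi =>
    half_sgn_mul_eq hG hδ' (hε' i) (hCE' i hi)
  have hCC' : ∀ i < l, ∀ j < l', C.edge i ≠ C'.edge j := by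
    intro i hi j hj hij
    obtain ⟨j', hj', h'⟩ := Walk.exists_vert_eq_of_mem_edge hC'.1 hj (v := C.vert i)
      (hij ▸ Sym2.mem_mk_left _ _)
    exact hdisj i hi j' hj' h'.symm
  have hhalf : ∀ i < l, 1 / 2 ≤ r (C.edge i) := fun i hi =>
    half_le_of_eq_add_half (h.isRep.1 _ (hCE i hi)) (h.exists_edge_eq_add_half hG hC hCF hi)
  have hhalf' : ∀ i < l', 1 / 2 ≤ r (C'.edge i) := fun i hi =>
    half_le_of_eq_add_half (h.isRep.1 _ (hCE' i hi)) (h.exists_edge_eq_add_half hG hC' hCF' hi)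
  have hP0 : ∀ e, 0 ≤ P.weight (fun _ => 1) e := fun e =>
    Finset.sum_nonneg fun i _ => by split_ifs <;> norm_num
  have hPint : ∀ e, P.weight (fun _ => 1) e ∈ integers := fun e =>
    sum_mem fun i _ => by split_ifs <;> [exact one_mem _; exact zero_mem _]
  set t : Sym2 V → ℚ := fun e => C.weight w e + C'.weight w' e + P.weight (fun _ => 1) e with ht
  have htC : ∀ i < l, t (C.edge i) = w i + P.weight (fun _ => 1) (C.edge i) := fun i hi => by
    simp only [ht, hC.weight_edge w hi,
      C'.weight_eq_zero w' fun j hj h' => hCC' i hi j hj h'.symm, add_zero]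
  have htC' : ∀ i < l', t (C'.edge i) = w' i + P.weight (fun _ => 1) (C'.edge i) := fun i hi => by
    simp only [ht, hC'.weight_edge w' hi,
      C.weight_eq_zero w fun j hj h' => hCC' j hj i hi h', zero_add]
  have htP : ∀ e, (∀ i < l, C.edge i ≠ e) → (∀ i < l', C'.edge i ≠ e) →
      t e = P.weight (fun _ => 1) e := fun e h1 h2 => by
    simp only [ht, C.weight_eq_zero w h1, C'.weight_eq_zero w' h2, zero_add]
  have hC0 := mem_fracSupport.1 (hCF 0 hC.2.1)
  refine hC0.2 (h.mem_integers_of_add (t := t) ?_ ?_ ?_ hC0.1 ?_)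
  · intro v
    simp only [ht, add_mul, Finset.sum_add_distrib]
    rw [C.sum_weight_mul w hCE, C'.sum_weight_mul w' hCE', P.sum_weight_mul _ P.mem,
      Walk.IsClosed.sum_half_sgn_mul_rho hG δ hεsum v,
      Walk.IsClosed.sum_half_sgn_mul_rho hG δ' hεsum' v]
    simp only [one_mul]
    rw [← Int.cast_sum, hδsum v, hPa, hPa']
    push_cast
    ring
  · intro e he
    by_cases h1 : ∃ i < l, C.edge i = e
    · obtain ⟨i, hi, rfl⟩ := h1
      rw [htC i hi]
      rcases hwv i hi with h' | h' <;> linarith [hhalf i hi, hP0 (C.edge i)]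
    by_cases h2 : ∃ i < l', C'.edge i = e
    · obtain ⟨i, hi, rfl⟩ := h2
      rw [htC' i hi]
      rcases hwv' i hi with h' | h' <;> linarith [hhalf' i hi, hP0 (C'.edge i)]
    push Not at h1 h2
    rw [htP e h1 h2]
    exact add_nonneg (h.isRep.1 e he) (hP0 e)
  · intro e he hr
    rw [htP e]
    · exact hPint e
    · rintro i hi rfl
      exact (mem_fracSupport.1 (hCF i hi)).2 hr
    · rintro i hi rfl
      exact (mem_fracSupport.1 (hCF' i hi)).2 hr
  · obtain ⟨m, hm⟩ := h.exists_edge_eq_add_half hG hC hCF hC.2.1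
    rw [htC 0 hC.2.1, hm, ← add_assoc]
    refine add_mem ?_ (hPint _)
    rcases hwv 0 hC.2.1 with h' | h' <;> rw [h']
    · convert intCast_mem integers (m + 1) using 1
      push_cast; ring
    · convert intCast_mem integers m using 1
      ring

theorem exists_eq_sum_of_mem_addSubgroupClosure (hz : z ∈ AddSubgroup.closure (G.rho '' G.edges)) :
    ∃ b : Sym2 V → ℤ, ∀ v, z v = ∑ e ∈ G.edges, b e * G.rho e v := by
  induction hz using AddSubgroup.closure_induction with
  | mem x hx =>
    obtain ⟨e, he, rfl⟩ := hx
    exact ⟨Pi.single e 1, fun v => by simp [Pi.single_apply, Finset.mem_coe.1 he]⟩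
  | zero => exact ⟨0, fun v => by simp⟩
  | add x y _ _ hx hy =>
    obtain ⟨b, hb⟩ := hx
    obtain ⟨c, hc⟩ := hy
    exact ⟨b + c, fun v => by simp [hb, hc, add_mul, Finset.sum_add_distrib]⟩
  | neg x _ hx =>
    obtain ⟨b, hb⟩ := hx
    exact ⟨-b, fun v => by simp [hb]⟩

theorem exists_eq_sum_of_mem_addSubmonoidClosure
    (hz : z ∈ AddSubmonoid.closure (G.rho '' G.edges)) :
    ∃ b : Sym2 V → ℕ, ∀ v, z v = ∑ e ∈ G.edges, b e * G.rho e v := by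
  induction hz using AddSubmonoid.closure_induction with
  | mem x hx =>
    obtain ⟨e, he, rfl⟩ := hx
    exact ⟨Pi.single e 1, fun v => by simp [Pi.single_apply, Finset.mem_coe.1 he]⟩
  | zero => exact ⟨0, fun v => by simp⟩
  | add x y _ _ hx hy =>
    obtain ⟨b, hb⟩ := hx
    obtain ⟨c, hc⟩ := hy
    exact ⟨b + c, fun v => by simp [hb, hc, add_mul, Finset.sum_add_distrib]⟩

/-- The semigroup generated by the edge vectors is normal under the odd cycle condition. -/
theorem mem_closure_of_nsmul_mem (hG : G.Proper) (hocc : G.OddCycleCondition) {n : ℕ} (hn : 0 < n)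
    (hz : z ∈ AddSubgroup.closure (G.rho '' G.edges))
    (hnz : n • z ∈ AddSubmonoid.closure (G.rho '' G.edges)) :
    z ∈ AddSubmonoid.closure (G.rho '' G.edges) := by
  obtain ⟨b, hb⟩ := exists_eq_sum_of_mem_addSubgroupClosure hz
  obtain ⟨c, hc⟩ := exists_eq_sum_of_mem_addSubmonoidClosure hnz
  have hn' : (n : ℚ) ≠ 0 := by positivity
  have hrep : G.IsRep z fun e => c e / n := by
    refine ⟨fun e _ => by positivity, fun v => mul_left_cancel₀ hn' ?_⟩
    have h1 : (n : ℚ) * z v = ((n • z) v : ℤ) := by simp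
    rw [h1, hc v, Finset.mul_sum]
    push_cast
    exact Finset.sum_congr rfl fun e _ => by field_simp
  obtain ⟨r, hr⟩ := hrep.exists_isMinRep
  have hF := hr.fracSupport_eq_empty hG hocc hb
  have hint : ∀ e ∈ G.edges, ∃ m : ℕ, (m : ℚ) = r e := by
    intro e he
    have h1 : r e ∈ integers := by
      by_contra h'
      have := mem_fracSupport.2 ⟨he, h'⟩
      simp [hF] at this
    obtain ⟨m, hm⟩ := h1
    have hm : (m : ℚ) = r e := hm
    have h0 : (0 : ℚ) ≤ m := hm ▸ hr.isRep.1 e he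
    lift m to ℕ using by exact_mod_cast h0
    exact ⟨m, by exact_mod_cast hm⟩
  choose! m hm using hint
  have hz' : z = ∑ e ∈ G.edges, m e • G.rho e := by
    ext v
    have h1 := hr.isRep.2 v
    rw [Finset.sum_congr rfl fun e he => by rw [← hm e he]] at h1
    rw [Finset.sum_apply]
    simp only [Pi.smul_apply, nsmul_eq_mul]
    exact_mod_cast h1
  rw [hz']
  exact sum_mem fun e he =>
    nsmul_mem (AddSubmonoid.subset_closure (Set.mem_image_of_mem G.rho he)) _

end SignedGraph

/-- the odd cycle condition implies that the edge ring `k[G]` is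
a normal domain. -/
theorem statement10 {V : Type} [DecidableEq V] (k : Type) [Field k]
    (G : SignedGraph V) (hsgn : G.Proper) (hocc : G.OddCycleCondition) :
    IsDomain ↥(edgeRing k G) ∧ IsIntegrallyClosed ↥(edgeRing k G) := by
  refine ⟨inferInstance, ?_⟩
  have h := AddMonoidAlgebra.isIntegrallyClosed_adjoin_single k
    (G.edges.finite_toSet.image G.rho) fun n z hz hn hnz =>
      SignedGraph.mem_closure_of_nsmul_mem hsgn hocc hn hz hnz
  rwa [Set.image_image] at h
end

section
/- Let G be a directed graph (no signed edges), with edge ring k[G] ⊆ k[x_1^{±1},...,x_n^{±1}] generated by the monomials x_i^{-1} x_j for directed edges (i,j). Then k[G] is a normal domain. -/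
open Finset

/-- The exponent vector `e_j - e_i` of the generator `x_i⁻¹ x_j` of a directed
edge `(i,j)`. -/
def dirVec {V : Type} [DecidableEq V] (d : V × V) : V → ℤ :=
  Pi.single d.2 1 - Pi.single d.1 1

/-- If `z` is nonnegative on every up-closed set and has total sum zero, it is a nonnegative
integer combination of the vectors `e_b - e_a` over the arrows `a → b`. -/
theorem mem_closure_single_sub_single {W : Type} [Fintype W] [DecidableEq W]
    (r : W → W → Prop) (z : W → ℤ) (h0 : ∑ w, z w = 0)
    (h : ∀ U : Finset W, (∀ a b, r a b → a ∈ U → b ∈ U) → 0 ≤ ∑ w ∈ U, z w) :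
    z ∈ AddSubmonoid.closure
      {y : W → ℤ | ∃ a b, r a b ∧ y = Pi.single b 1 - Pi.single a 1} := by
  classical
  induction hn : ∑ w, (z w).natAbs using Nat.strong_induction_on generalizing z with
  | _ n ih =>
  by_cases hz : z = 0
  · simp [hz]
  obtain ⟨u, hu⟩ : ∃ u, 0 < z u := by
    by_contra! hneg
    exact hz (funext fun w =>
      (Finset.sum_eq_zero_iff_of_nonpos (fun w _ => hneg w)).1 h0 w (Finset.mem_univ w))
  have tight : ∃ T : Finset W, ((∀ a b, r a b → a ∈ T → b ∈ T) ∧ u ∈ T ∧ ∑ w ∈ T, z w = 0) ∧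
      ∀ U : Finset W, ((∀ a b, r a b → a ∈ U → b ∈ U) ∧ u ∈ U ∧ ∑ w ∈ U, z w = 0) → T ⊆ U := by
    obtain ⟨T, hT, hmin⟩ := Finset.exists_min_image (Finset.univ.filter fun T : Finset W =>
      (∀ a b, r a b → a ∈ T → b ∈ T) ∧ u ∈ T ∧ ∑ w ∈ T, z w = 0) Finset.card
      ⟨Finset.univ, by simp [h0]⟩
    simp only [Finset.mem_filter, Finset.mem_univ, true_and] at hT hmin
    refine ⟨T, hT, fun U hU => ?_⟩
    have hi := h (T ∩ U) fun a b hab ha => by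
      simp only [Finset.mem_inter] at ha ⊢
      exact ⟨hT.1 a b hab ha.1, hU.1 a b hab ha.2⟩
    have hun := h (T ∪ U) fun a b hab ha => by
      simp only [Finset.mem_union] at ha ⊢
      exact ha.imp (hT.1 a b hab) (hU.1 a b hab)
    have hsum := Finset.sum_union_inter (s₁ := T) (s₂ := U) (f := z)
    have := hmin (T ∩ U) ⟨fun a b hab ha => by
      simp only [Finset.mem_inter] at ha ⊢
      exact ⟨hT.1 a b hab ha.1, hU.1 a b hab ha.2⟩, by simp [hT.2.1, hU.2.1], by
        linarith [hT.2.2, hU.2.2]⟩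
    exact Finset.inter_eq_left.1 (Finset.eq_of_subset_of_card_le Finset.inter_subset_left this)
  obtain ⟨T, ⟨hTup, huT, hT0⟩, hTmin⟩ := tight
  obtain ⟨v, hvT, hvu, hv⟩ : ∃ v ∈ T, Relation.ReflTransGen r v u ∧ z v < 0 := by
    by_contra! hcon
    have hR := h (T.filter fun w => ¬ Relation.ReflTransGen r w u) fun a b hab ha => by
      simp only [Finset.mem_filter] at ha ⊢
      exact ⟨hTup a b hab ha.1, fun hb => ha.2 (.head hab hb)⟩
    have hsplit := Finset.sum_filter_add_sum_filter_not T (fun w => Relation.ReflTransGen r w u) z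
    have hpos : 0 < ∑ w ∈ T.filter fun w => Relation.ReflTransGen r w u, z w :=
      Finset.sum_pos' (fun w hw => hcon w (Finset.mem_filter.1 hw).1 (Finset.mem_filter.1 hw).2)
        ⟨u, by simp [huT, Relation.ReflTransGen.refl], hu⟩
    linarith
  have huv : u ≠ v := by rintro rfl; omega
  have hpath : (Pi.single u 1 - Pi.single v 1 : W → ℤ) ∈ AddSubmonoid.closure
      {y : W → ℤ | ∃ a b, r a b ∧ y = Pi.single b 1 - Pi.single a 1} := by
    clear hu hn hvT hv huv huT hTmin
    induction hvu with
    | refl => simp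
    | @tail b c _ hbc hb =>
      have := add_mem hb (AddSubmonoid.subset_closure (⟨b, c, hbc, rfl⟩ :
        (Pi.single c 1 - Pi.single b 1 : W → ℤ) ∈
          {y : W → ℤ | ∃ a b, r a b ∧ y = Pi.single b 1 - Pi.single a 1}))
      rwa [sub_add_sub_comm, add_comm (Pi.single b 1), add_sub_add_right_eq_sub] at this
  have hsub (U : Finset W) : ∑ w ∈ U, (z - (Pi.single u 1 - Pi.single v 1) : W → ℤ) w =
      ∑ w ∈ U, z w - (if u ∈ U then 1 else 0) + (if v ∈ U then 1 else 0) := by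
    simp [Finset.sum_sub_distrib, Pi.single_apply]
    ring
  rw [← sub_add_cancel z (Pi.single u 1 - Pi.single v 1)]
  refine add_mem (ih _ ?_ _ ?_ ?_ rfl) hpath
  · rw [← hn]
    refine Finset.sum_lt_sum (fun w _ => ?_) ⟨u, Finset.mem_univ u, ?_⟩
    · rcases eq_or_ne w u with rfl | hwu
      · simp [huv]; omega
      · rcases eq_or_ne w v with rfl | hwv
        · simp [hwu]; omega
        · simp [hwu, hwv]
    · simp [huv]; omega
  · rw [hsub]; simp [h0]
  · intro U hU
    rw [hsub]
    have hUz := h U hU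
    by_cases huU : u ∈ U
    · by_cases hvU : v ∈ U
      · simpa [huU, hvU] using hUz
      · have : ∑ w ∈ U, z w ≠ 0 := fun h0 => hvU (hTmin U ⟨hU, huU, h0⟩ hvT)
        simp [huU, hvU]; omega
    · simp [huU]; split_ifs <;> omega

/-- The Laurent polynomial ring in finitely many variables over a field is integrally closed. -/
theorem isIntegrallyClosed_laurent (k : Type) [Field k] (W : Type) [Finite W] :
    IsIntegrallyClosed (AddMonoidAlgebra k (W → ℤ)) := by
  classical
  let ι : (W →₀ ℕ) →+ (W → ℤ) :=
    { toFun := fun m w => m w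
      map_zero' := by ext; simp
      map_add' := fun a b => by ext; simp }
  have hι : Function.Injective ι := fun a b hab => Finsupp.ext fun w => by
    have : (a w : ℤ) = b w := congrFun hab w
    exact_mod_cast this
  let F : MvPolynomial W k →ₐ[k] AddMonoidAlgebra k (W → ℤ) :=
    AddMonoidAlgebra.mapDomainAlgHom k k ι
  have hF : Function.Injective F := AddMonoidAlgebra.mapDomain_injective hι
  have hmon (m : W →₀ ℕ) (c : k) :
      F (MvPolynomial.monomial m c) = AddMonoidAlgebra.single (ι m) c :=
    AddMonoidAlgebra.mapDomain_single
  let _ : Algebra (MvPolynomial W k) (AddMonoidAlgebra k (W → ℤ)) := F.toRingHom.toAlgebra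
  let N : Submonoid (MvPolynomial W k) := MonoidHom.mrange (MvPolynomial.monomialOneHom k W)
  have hN : N ≤ nonZeroDivisors (MvPolynomial W k) := by
    rintro _ ⟨m, rfl⟩
    refine mem_nonZeroDivisors_of_ne_zero ?_
    exact (MvPolynomial.monomial_eq_zero (s := m.toAdd) (b := (1 : k))).not.2 one_ne_zero
  have : IsLocalization N (AddMonoidAlgebra k (W → ℤ)) := by
    refine ⟨?_, ?_, ?_⟩
    · rintro ⟨_, m, rfl⟩
      refine IsUnit.of_mul_eq_one (AddMonoidAlgebra.single (-ι m.toAdd) 1) ?_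
      change F (MvPolynomial.monomial m.toAdd 1) * _ = 1
      rw [hmon, AddMonoidAlgebra.single_mul_single]
      simp [AddMonoidAlgebra.one_def]
    · intro f
      induction f using AddMonoidAlgebra.induction_linear with
      | zero => exact ⟨(0, 1), by simp⟩
      | add f g hf hg =>
        obtain ⟨⟨p, s⟩, hp⟩ := hf
        obtain ⟨⟨q, t⟩, hq⟩ := hg
        refine ⟨(p * t + q * s, s * t), ?_⟩
        simp only [Submonoid.coe_mul, map_mul, map_add] at hp hq ⊢
        rw [← hp, ← hq]
        ring
      | single z c =>
        let a : W →₀ ℕ := Finsupp.equivFunOnFinite.symm fun w => (z w).toNat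
        let b : W →₀ ℕ := Finsupp.equivFunOnFinite.symm fun w => (-z w).toNat
        refine ⟨(MvPolynomial.monomial a c, ⟨MvPolynomial.monomial b 1,
          Multiplicative.ofAdd b, rfl⟩), ?_⟩
        change _ * F (MvPolynomial.monomial b 1) = F (MvPolynomial.monomial a c)
        rw [hmon, hmon, AddMonoidAlgebra.single_mul_single, mul_one]
        congr 1
        ext w
        change z w + ((-z w).toNat : ℤ) = (z w).toNat
        omega
    · intro x y hxy
      exact ⟨1, by rw [hF hxy]⟩
  exact isIntegrallyClosed_of_isLocalization (R := MvPolynomial W k) _ N hN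

/-- The grading of a group algebra by an integer weight `φ` on exponents, as a homomorphism to
Hahn series. -/
noncomputable def AddMonoidAlgebra.toHahnSeries {k M : Type} [Field k] [AddCommGroup M]
    (φ : M →+ ℤ) : AddMonoidAlgebra k M →+* HahnSeries ℤ (AddMonoidAlgebra k M) :=
  AddMonoidAlgebra.liftNCRingHom (HahnSeries.C.comp AddMonoidAlgebra.singleZeroRingHom)
    { toFun := fun m => HahnSeries.single (φ m.toAdd) (AddMonoidAlgebra.single m.toAdd 1)
      map_one' := by simp; rfl
      map_mul' := fun a b => by simp }
    fun _ _ => Commute.all _ _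

theorem AddMonoidAlgebra.coeff_coeff_toHahnSeries {k M : Type} [Field k] [AddCommGroup M]
    (φ : M →+ ℤ) (f : AddMonoidAlgebra k M) (n : ℤ) (z : M) :
    ((toHahnSeries φ f).coeff n).coeff z = if φ z = n then f.coeff z else 0 := by
  classical
  induction f using AddMonoidAlgebra.induction_linear with
  | zero => simp
  | add f g hf hg =>
    simp only [map_add, HahnSeries.coeff_add, AddMonoidAlgebra.coeff_add, Finsupp.add_apply, hf, hg]
    split_ifs <;> simp
  | single m c =>
    have hs : toHahnSeries φ (single m c) = HahnSeries.single (φ m) (single m c) := by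
      refine (liftNC_single _ _ _ _).trans ?_
      simp [HahnSeries.C_apply]
    rw [hs, HahnSeries.coeff_single]
    by_cases h : m = z
    · subst h
      by_cases h2 : φ m = n
      · simp [h2]
      · simp [h2, Ne.symm h2]
    · by_cases h2 : φ m = n
      · simp [h2, h]
      · simp [h, Ne.symm h2]

/-- An element integral over a subalgebra whose exponents have nonnegative weight has exponents of
nonnegative weight. -/
theorem AddMonoidAlgebra.nonneg_of_isIntegral {k M : Type} [Field k] [AddCommGroup M]
    [IsDomain (AddMonoidAlgebra k M)] (φ : M →+ ℤ) (A : Subalgebra k (AddMonoidAlgebra k M))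
    (hA : ∀ f ∈ A, ∀ z, f.coeff z ≠ 0 → 0 ≤ φ z) {f : AddMonoidAlgebra k M}
    (hf : IsIntegral A f) (z : M) (hz : f.coeff z ≠ 0) : 0 ≤ φ z := by
  let v := (HahnSeries.addVal ℤ (AddMonoidAlgebra k M)).toValuation.comap
    (toHahnSeries φ)
  have key (g : AddMonoidAlgebra k M) : g ∈ v.integer ↔ ∀ z, g.coeff z ≠ 0 → 0 ≤ φ z := by
    have : g ∈ v.integer ↔ 0 ≤ (toHahnSeries φ g).orderTop := by
      rw [← HahnSeries.addVal_apply]; rfl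
    rw [this]
    constructor
    · intro h z hz
      have := h.trans (HahnSeries.orderTop_le_of_coeff_ne_zero
        (x := toHahnSeries φ g) (g := φ z) fun h0 => hz ?_)
      · exact_mod_cast this
      · simpa [h0] using (coeff_coeff_toHahnSeries φ g (φ z) z).symm
    · intro h
      by_contra! hlt
      obtain ⟨n, hn⟩ := WithTop.ne_top_iff_exists.1 (ne_top_of_lt hlt)
      have h0 := HahnSeries.coeff_orderTop_ne hn.symm
      refine h0 (AddMonoidAlgebra.ext (Finsupp.ext fun z => ?_))
      rw [coeff_coeff_toHahnSeries, AddMonoidAlgebra.coeff_zero, Finsupp.coe_zero, Pi.zero_apply,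
        ite_eq_right_iff]
      rintro rfl
      by_contra hz
      rw [← hn] at hlt
      exact absurd (h z hz) (by exact_mod_cast hlt.not_ge)
  refine (key f).1 ((Valuation.integer.integers v).mem_of_integral ?_) z hz
  obtain ⟨p, hp, hpf⟩ := hf
  let j : A →+* v.integer := (A.val.toRingHom).codRestrict _ fun a => (key _).2 (hA a a.2)
  refine ⟨p.map j, hp.map j, ?_⟩
  rw [Polynomial.eval₂_map]
  exact hpf

/-- The edge ring of a digraph consists of the Laurent polynomials whose exponents satisfy every
integer linear inequality valid on the generators. -/
theorem mem_adjoin_dirVec_iff {W : Type} [Fintype W] [DecidableEq W] (k : Type) [Field k]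
    (E : Set (W × W)) (f : AddMonoidAlgebra k (W → ℤ)) :
    f ∈ Algebra.adjoin k ((fun d => mono k (dirVec d)) '' E) ↔
      ∀ φ : (W → ℤ) →+ ℤ, (∀ d ∈ E, 0 ≤ φ (dirVec d)) → ∀ z, f.coeff z ≠ 0 → 0 ≤ φ z := by
  classical
  constructor
  · intro hf φ hφ
    induction hf using Algebra.adjoin_induction with
    | mem x hx =>
      obtain ⟨d, hd, rfl⟩ := hx
      intro z hz
      obtain rfl : dirVec d = z := by
        by_contra hne
        simp [mono, hne] at hz
      exact hφ d hd
    | algebraMap r =>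
      intro z hz
      obtain rfl : 0 = z := by
        by_contra hne
        simp [hne] at hz
      simp
    | add x y _ _ hx hy =>
      intro z hz
      by_cases h : x.coeff z = 0
      · exact hy z fun h' => hz (by simp [h, h'])
      · exact hx z h
    | mul x y _ _ hx hy =>
      intro z hz
      have := AddMonoidAlgebra.support_coeff_mul_subset x y (Finsupp.mem_support_iff.2 hz)
      obtain ⟨a, ha, b, hb, rfl⟩ := Finset.mem_add.1 this
      rw [map_add]
      exact add_nonneg (hx a (Finsupp.mem_support_iff.1 ha)) (hy b (Finsupp.mem_support_iff.1 hb))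
  · intro h
    have hcl (z : W → ℤ) (hz : f.coeff z ≠ 0) : z ∈ AddSubmonoid.closure (dirVec '' E) := by
      have hset : dirVec '' E =
          {y : W → ℤ | ∃ a b, (a, b) ∈ E ∧ y = Pi.single b 1 - Pi.single a 1} := by
        ext y
        simp [dirVec, eq_comm]
      let s (U : Finset W) : (W → ℤ) →+ ℤ := ∑ w ∈ U, Pi.evalAddMonoidHom (fun _ => ℤ) w
      have hs (U : Finset W) (y : W → ℤ) : s U y = ∑ w ∈ U, y w := by simp [s]
      have hsd (U : Finset W) (d : W × W) :
          s U (dirVec d) = (if d.2 ∈ U then 1 else 0) - if d.1 ∈ U then 1 else 0 := by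
        simp [hs, dirVec, Finset.sum_sub_distrib, Pi.single_apply]
      rw [hset]
      refine mem_closure_single_sub_single (fun a b => (a, b) ∈ E) z (le_antisymm ?_ ?_) ?_
      · have := h (-s Finset.univ) (fun d _ => by simp [hsd]) z hz
        simpa [hs] using this
      · have := h (s Finset.univ) (fun d _ => by simp [hsd]) z hz
        simpa [hs] using this
      · intro U hU
        rw [← hs]
        refine h (s U) (fun d hd => ?_) z hz
        rw [hsd]
        by_cases h1 : d.1 ∈ U
        · simp [h1, hU _ _ hd h1]
        · simp only [h1, if_false]; split_ifs <;> simp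
    have hmono (z : W → ℤ) (hz : z ∈ AddSubmonoid.closure (dirVec '' E)) :
        mono k z ∈ Algebra.adjoin k ((fun d => mono k (dirVec d)) '' E) := by
      induction hz using AddSubmonoid.closure_induction with
      | mem x hx =>
        obtain ⟨d, hd, rfl⟩ := hx
        exact Algebra.subset_adjoin ⟨d, hd, rfl⟩
      | zero => exact one_mem _
      | add x y _ _ hx hy =>
        have := mul_mem hx hy
        rwa [mono, mono, AddMonoidAlgebra.single_mul_single, one_mul] at this
    rw [← AddMonoidAlgebra.sum_coeff_single f]
    refine Subalgebra.sum_mem _ fun z hz => ?_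
    have := Subalgebra.smul_mem _ (hmono z (hcl z (Finsupp.mem_support_iff.1 hz))) (f.coeff z)
    simpa [mono] using this

/-- A subalgebra of an integrally closed domain that is integrally closed in it is an integrally
closed domain. -/
theorem isIntegrallyClosed_of_isIntegral_mem {k B : Type} [Field k] [CommRing B] [IsDomain B]
    [Algebra k B] [IsIntegrallyClosed B] (A : Subalgebra k B)
    (h : ∀ x : B, IsIntegral A x → x ∈ A) : IsIntegrallyClosed A := by
  rw [isIntegrallyClosed_iff (FractionRing A)]
  intro x hx
  let g : FractionRing A →+* FractionRing B :=
    IsFractionRing.map (A := A) (B := B) (K := FractionRing A) (L := FractionRing B)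
      (j := A.val.toRingHom) Subtype.val_injective
  have hg (a : A) : g (algebraMap A (FractionRing A) a) = algebraMap B (FractionRing B) a :=
    IsLocalization.map_eq _ a
  have hgx : IsIntegral A (g x) := by
    obtain ⟨p, hp, hpx⟩ := hx
    refine ⟨p, hp, ?_⟩
    have := congrArg g hpx
    rw [Polynomial.hom_eval₂, map_zero] at this
    rw [← this]
    congr 1
    ext a
    rw [RingHom.comp_apply, hg]
    rfl
  obtain ⟨b, hb⟩ := (isIntegrallyClosed_iff (FractionRing B)).1 ‹_› (hgx.tower_top (A := B))
  have hbA : b ∈ A := h b <| by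
    rw [← hb] at hgx
    exact (isIntegral_algebraMap_iff (IsFractionRing.injective B (FractionRing B))).1 hgx
  exact ⟨⟨b, hbA⟩, g.injective (by rw [hg, hb])⟩

/-- the edge ring of a directed graph, generated by the
monomials `x_i⁻¹ x_j` over its directed edges, is a normal domain. -/
theorem statement15 {V : Type} [DecidableEq V] (k : Type) [Field k]
    (E : Finset (V × V)) (hE : ∀ d ∈ E, d.1 ≠ d.2) :
    IsDomain ↥(Algebra.adjoin k ((fun d => mono k (dirVec d)) '' (E : Set (V × V)))) ∧
      IsIntegrallyClosed ↥(Algebra.adjoin k ((fun d => mono k (dirVec d)) '' (E : Set (V × V)))) := by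
  refine ⟨inferInstance, ?_⟩
  let S : Finset V := E.image Prod.fst ∪ E.image Prod.snd
  let E' : Set (S × S) := {d | ((d.1 : V), (d.2 : V)) ∈ E}
  let ι : (S → ℤ) →+ (V → ℤ) :=
    { toFun := fun z v => if h : v ∈ S then z ⟨v, h⟩ else 0
      map_zero' := by ext; simp
      map_add' := fun a b => by
        ext v
        by_cases h : v ∈ S <;> simp [h] }
  have hι : Function.Injective ι := fun a b hab => funext fun w => by
    simpa [ι] using congrFun hab w
  let F : AddMonoidAlgebra k (S → ℤ) →ₐ[k] AddMonoidAlgebra k (V → ℤ) :=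
    AddMonoidAlgebra.mapDomainAlgHom k k ι
  have hF : Function.Injective F := AddMonoidAlgebra.mapDomain_injective hι
  have hsingle (w : S) : ι (Pi.single w 1) = Pi.single (w : V) 1 := by
    ext v
    by_cases h : v ∈ S
    · simp [ι, h, Pi.single_apply, Subtype.ext_iff]
    · have : v ≠ w := fun e => h (e ▸ w.2)
      simp [ι, h, this]
  have hFmono (d : S × S) : F (mono k (dirVec d)) = mono k (dirVec ((d.1 : V), (d.2 : V))) := by
    refine AddMonoidAlgebra.mapDomain_single.trans ?_
    simp only [dirVec, map_sub, hsingle, mono]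
  have hmap : (Algebra.adjoin k ((fun d => mono k (dirVec d)) '' E')).map F =
      Algebra.adjoin k ((fun d => mono k (dirVec d)) '' (E : Set (V × V))) := by
    rw [AlgHom.map_adjoin, Set.image_image]
    congr 1
    ext y
    constructor
    · rintro ⟨d, hd, rfl⟩
      exact ⟨_, hd, (hFmono d).symm⟩
    · rintro ⟨d, hd, rfl⟩
      have h1 : d.1 ∈ S := Finset.mem_union_left _ (Finset.mem_image_of_mem _ hd)
      have h2 : d.2 ∈ S := Finset.mem_union_right _ (Finset.mem_image_of_mem _ hd)
      exact ⟨(⟨d.1, h1⟩, ⟨d.2, h2⟩), hd, hFmono _⟩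
  rw [← hmap]
  have := isIntegrallyClosed_laurent k S
  have hA : IsIntegrallyClosed (Algebra.adjoin k ((fun d => mono k (dirVec d)) '' E')) := by
    refine isIntegrallyClosed_of_isIntegral_mem _ fun x hx => ?_
    rw [mem_adjoin_dirVec_iff]
    intro φ hφ z hz
    exact AddMonoidAlgebra.nonneg_of_isIntegral φ _
      (fun f hf => (mem_adjoin_dirVec_iff k E' f).1 hf φ hφ) hx z hz
  exact IsIntegrallyClosed.of_equiv (Subalgebra.equivMapOfInjective _ F hF).toRingEquiv
end
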